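/- arXiv:2011.06199 — 19 statements merged into one kernel-verified Lean document; each statement's English description precedes it below -/
import Mathlib

section
/- Let 0 < α ≤ 1/2 be a real number. Then H_α(x) > 0 for every x in the open interval (0, 2π). -/
/-- For `0 < α ≤ 1/2`, the function `H_α(x) = sin (α x) - α sin x` is positive on `(0, 2π)`. -/
theorem Halpha_pos_of_le_half (α : ℝ) (hα0 : 0 < α) (hα : α ≤ 1 / 2) :
    ∀ x ∈ Set.Ioo (0 : ℝ) (2 * Real.pi), Real.sin (α * x) - α * Real.sin x > 0 := by
  rintro x ⟨hx0, hx⟩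
  rcases le_or_gt x Real.pi with h | h
  · have hx1 : x ∈ Set.Icc 0 Real.pi := ⟨hx0.le, h⟩
    have hz : (0 : ℝ) ∈ Set.Icc 0 Real.pi := ⟨le_rfl, Real.pi_pos.le⟩
    have h3 : 0 < 1 - α := by linarith
    have := strictConcaveOn_sin_Icc.2 hx1 hz hx0.ne' hα0 h3 (by ring)
    simp only [smul_eq_mul, Real.sin_zero, mul_zero, add_zero] at this
    linarith
  · have h1 : 0 < Real.sin (α * x) :=
      Real.sin_pos_of_pos_of_lt_pi (by positivity) (by nlinarith)
    have h2 : 0 ≤ Real.sin (x - Real.pi) :=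
      Real.sin_nonneg_of_nonneg_of_le_pi (by linarith) (by linarith)
    rw [Real.sin_sub_pi] at h2
    nlinarith
end

section
/- Let 1/2 < α < 1 be a real number. Then there exists y* ∈ (0, 2π) such that H_α(y*) = 0, H_α(x) > 0 for all x ∈ (0, y*), and H_α(x) < 0 for all x ∈ (y*, 2π). In particular y* is the unique zero of H_α in (0, 2π). -/
/-- For `1/2 < α < 1`, the function `H_α(x) = sin (α x) - α sin x` has a unique zero `y*` in
`(0, 2π)`, is positive on `(0, y*)` and negative on `(y*, 2π)`. -/
theorem Halpha_sign_of_half_lt_lt_one (α : ℝ) (hα0 : 1 / 2 < α) (hα1 : α < 1) :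
    ∃ y ∈ Set.Ioo (0 : ℝ) (2 * Real.pi),
      Real.sin (α * y) - α * Real.sin y = 0 ∧
      (∀ x ∈ Set.Ioo (0 : ℝ) y, Real.sin (α * x) - α * Real.sin x > 0) ∧
      (∀ x ∈ Set.Ioo y (2 * Real.pi), Real.sin (α * x) - α * Real.sin x < 0) ∧
      (∀ x ∈ Set.Ioo (0 : ℝ) (2 * Real.pi),
        Real.sin (α * x) - α * Real.sin x = 0 → x = y) := by
  have hpi := Real.pi_pos
  obtain ⟨H, hH⟩ : ∃ H : ℝ → ℝ, H = fun x => Real.sin (α * x) - α * Real.sin x := ⟨_, rfl⟩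
  have hHx : ∀ x, Real.sin (α * x) - α * Real.sin x = H x := fun x => by rw [hH]
  simp only [hHx]
  have hcont : Continuous H := by rw [hH]; fun_prop
  have hder : ∀ x, deriv H x
      = 2 * α * (Real.sin ((1 + α) * x / 2) * Real.sin ((1 - α) * x / 2)) := by
    intro x
    have h1 : HasDerivAt H (Real.cos (α * x) * (α * 1) - α * Real.cos x) x := by
      rw [hH]
      exact (((hasDerivAt_id x).const_mul α).sin).sub ((Real.hasDerivAt_sin x).const_mul α)
    rw [h1.deriv]
    have h2 := Real.cos_sub_cos (α * x) x
    have e1 : (α * x + x) / 2 = (1 + α) * x / 2 := by ring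
    have e2 : (α * x - x) / 2 = -((1 - α) * x / 2) := by ring
    rw [e1, e2, Real.sin_neg] at h2
    linear_combination α * h2
  obtain ⟨c, hc⟩ : ∃ c : ℝ, c * (1 + α) = 2 * Real.pi :=
    ⟨2 * Real.pi / (1 + α), by field_simp⟩
  have hc0 : 0 < c := by
    by_contra h
    nlinarith
  have hc2 : c < 2 * Real.pi := by nlinarith
  have hs : ∀ x, 0 < x → x < 2 * Real.pi → 0 < Real.sin ((1 - α) * x / 2) := by
    intro x h0 h1
    apply Real.sin_pos_of_pos_of_lt_pi
    · have := mul_pos (sub_pos.2 hα1) h0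
      linarith
    · nlinarith
  have hmono : StrictMonoOn H (Set.Icc 0 c) := by
    apply strictMonoOn_of_deriv_pos (convex_Icc _ _) hcont.continuousOn
    intro x hx
    rw [interior_Icc] at hx
    obtain ⟨h0, h1⟩ := hx
    rw [hder]
    have := hs x h0 (by linarith)
    have h3 : 0 < Real.sin ((1 + α) * x / 2) := by
      apply Real.sin_pos_of_pos_of_lt_pi
      · positivity
      · nlinarith
    positivity
  have hanti : StrictAntiOn H (Set.Icc c (2 * Real.pi)) := by
    apply strictAntiOn_of_deriv_neg (convex_Icc _ _) hcont.continuousOn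
    intro x hx
    rw [interior_Icc] at hx
    obtain ⟨h0, h1⟩ := hx
    rw [hder]
    have := hs x (by linarith) h1
    have h3 : 0 < Real.sin ((1 + α) * x / 2 - Real.pi) := by
      apply Real.sin_pos_of_pos_of_lt_pi
      · nlinarith
      · nlinarith
    rw [Real.sin_sub_pi] at h3
    have h4 := mul_pos h3 this
    have h5 : 0 < α := by linarith
    have h6 := mul_pos h5 h4
    linarith
  have hH0 : H 0 = 0 := by simp [hH]
  have hH2 : H (2 * Real.pi) < 0 := by
    rw [hH]
    have h3 : 0 < Real.sin (α * (2 * Real.pi) - Real.pi) := by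
      apply Real.sin_pos_of_pos_of_lt_pi
      · nlinarith
      · nlinarith
    rw [Real.sin_sub_pi] at h3
    simp only [Real.sin_two_pi]
    linarith
  have hHc : 0 < H c := by
    rw [← hH0]
    exact hmono ⟨le_rfl, hc0.le⟩ ⟨hc0.le, le_rfl⟩ hc0
  obtain ⟨y, ⟨hy1, hy2⟩, hy⟩ := intermediate_value_Ioo' hc2.le hcont.continuousOn ⟨hH2, hHc⟩
  have hP : ∀ x ∈ Set.Ioo (0 : ℝ) y, H x > 0 := by
    rintro x ⟨h0, h1⟩
    rcases le_total x c with h | h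
    · rw [← hH0]
      exact hmono ⟨le_rfl, hc0.le⟩ ⟨h0.le, h⟩ h0
    · rw [← hy]
      exact hanti ⟨h, by linarith⟩ ⟨hy1.le, hy2.le⟩ h1
  have hN : ∀ x ∈ Set.Ioo y (2 * Real.pi), H x < 0 := by
    rintro x ⟨h0, h1⟩
    rw [← hy]
    exact hanti ⟨hy1.le, hy2.le⟩ ⟨by linarith, h1.le⟩ h0
  refine ⟨y, ⟨by linarith, hy2⟩, hy, hP, hN, ?_⟩
  rintro x ⟨h0, h1⟩ hx
  rcases lt_trichotomy x y with h | h | h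
  · exact absurd hx (hP x ⟨h0, h⟩).ne'
  · exact h
  · exact absurd hx (hN x ⟨h, h1⟩).ne
end

section
/- Let 1 < α < 2 be a real number. Then there exists y* ∈ (0, 2π/α) such that H_α(y*) = 0, H_α(x) < 0 for all x ∈ (0, y*), and H_α(x) > 0 for all x ∈ (y*, 2π/α). In particular y* is the unique zero of H_α in (0, 2π/α). -/
/-- For `1 < α < 2`, the function `H_α(x) = sin (α x) - α sin x` has a unique zero `y*` in
`(0, 2π/α)`, is negative on `(0, y*)` and positive on `(y*, 2π/α)`. -/
theorem Halpha_sign_of_one_lt_lt_two (α : ℝ) (hα1 : 1 < α) (hα2 : α < 2) :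
    ∃ y ∈ Set.Ioo (0 : ℝ) (2 * Real.pi / α),
      Real.sin (α * y) - α * Real.sin y = 0 ∧
      (∀ x ∈ Set.Ioo (0 : ℝ) y, Real.sin (α * x) - α * Real.sin x < 0) ∧
      (∀ x ∈ Set.Ioo y (2 * Real.pi / α), Real.sin (α * x) - α * Real.sin x > 0) ∧
      (∀ x ∈ Set.Ioo (0 : ℝ) (2 * Real.pi / α),
        Real.sin (α * x) - α * Real.sin x = 0 → x = y) := by
  have hpi := Real.pi_pos
  have h0 : 0 < α := by linarith
  set H : ℝ → ℝ := fun x => Real.sin (α * x) - α * Real.sin x with hH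
  have hd : ∀ x, HasDerivAt H
      (-(2 * α) * (Real.sin ((α + 1) * x / 2) * Real.sin ((α - 1) * x / 2))) x := by
    intro x
    have h1 : HasDerivAt (fun x : ℝ => α * x) α x := by
      simpa using (hasDerivAt_id x).const_mul α
    have h2 := (h1.sin).sub ((Real.hasDerivAt_sin x).const_mul α)
    have h3 := Real.cos_sub_cos (α * x) x
    have e1 : (α + 1) * x / 2 = (α * x + x) / 2 := by ring
    have e2 : (α - 1) * x / 2 = (α * x - x) / 2 := by ring
    refine HasDerivAt.congr_deriv (f := H) h2 ?_
    rw [e1, e2]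
    linear_combination α * h3
  have hcont : Continuous H := by
    rw [hH]; fun_prop
  set b := 2 * Real.pi / α with hb
  set c := 2 * Real.pi / (α + 1) with hc
  have hbα : b * α = 2 * Real.pi := by rw [hb]; field_simp
  have hcα : c * (α + 1) = 2 * Real.pi := by rw [hc]; field_simp
  have hc0 : 0 < c := by positivity
  have hcb : c < b := by
    rw [hb, hc]; gcongr; linarith
  have hs : ∀ x, 0 < x → x < b → 0 < Real.sin ((α - 1) * x / 2) := by
    intro x hx0 hxb
    apply Real.sin_pos_of_pos_of_lt_pi
    · have : 0 < α - 1 := by linarith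
      positivity
    · nlinarith
  have hanti : StrictAntiOn H (Set.Icc 0 c) := by
    apply strictAntiOn_of_deriv_neg (convex_Icc _ _) hcont.continuousOn
    intro x hx
    rw [interior_Icc] at hx
    obtain ⟨hx0, hxc⟩ := hx
    rw [(hd x).deriv]
    have h1 := hs x hx0 (hxc.trans hcb)
    have h2 : 0 < Real.sin ((α + 1) * x / 2) := by
      apply Real.sin_pos_of_pos_of_lt_pi
      · positivity
      · nlinarith
    have : 0 < 2 * α * (Real.sin ((α + 1) * x / 2) * Real.sin ((α - 1) * x / 2)) := by
      positivity
    linarith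
  have hmono : StrictMonoOn H (Set.Icc c b) := by
    apply strictMonoOn_of_deriv_pos (convex_Icc _ _) hcont.continuousOn
    intro x hx
    rw [interior_Icc] at hx
    obtain ⟨hxc, hxb⟩ := hx
    rw [(hd x).deriv]
    have h1 := hs x (hc0.trans hxc) hxb
    have h2 : 0 < Real.sin ((α + 1) * x / 2 - Real.pi) := by
      apply Real.sin_pos_of_pos_of_lt_pi
      · nlinarith
      · nlinarith
    rw [Real.sin_sub_pi] at h2
    have : 0 < 2 * α * (-Real.sin ((α + 1) * x / 2) * Real.sin ((α - 1) * x / 2)) := by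
      positivity
    linarith
  have hH0 : H 0 = 0 := by simp [hH]
  have hneg : ∀ x, 0 < x → x ≤ c → H x < 0 := by
    intro x hx hxc
    have := hanti ⟨le_refl _, hc0.le⟩ ⟨hx.le, hxc⟩ hx
    rwa [hH0] at this
  have hHb : 0 < H b := by
    have h1 : 0 < Real.sin (b - Real.pi) := by
      apply Real.sin_pos_of_pos_of_lt_pi
      · nlinarith
      · nlinarith
    rw [Real.sin_sub_pi] at h1
    have h2 : H b = α * (-Real.sin b) := by
      simp only [hH]
      rw [mul_comm α b, hbα, Real.sin_two_pi]; ring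
    rw [h2]; positivity
  obtain ⟨y, ⟨hyc, hyb⟩, hy⟩ : (0:ℝ) ∈ H '' Set.Ioo c b :=
    intermediate_value_Ioo hcb.le hcont.continuousOn ⟨hneg c hc0 le_rfl, hHb⟩
  have hA : ∀ x ∈ Set.Ioo (0 : ℝ) y, H x < 0 := by
    intro x hx
    rcases le_total x c with h | h
    · exact hneg x hx.1 h
    · rw [← hy]
      exact hmono ⟨h, (hx.2.trans hyb).le⟩ ⟨hyc.le, hyb.le⟩ hx.2
  have hB : ∀ x ∈ Set.Ioo y b, H x > 0 := by
    intro x hx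
    have := hmono ⟨hyc.le, hyb.le⟩ ⟨(hyc.trans hx.1).le, hx.2.le⟩ hx.1
    rwa [hy] at this
  refine ⟨y, ⟨hc0.trans hyc, hyb⟩, hy, hA, hB, ?_⟩
  intro x hx hx0
  have hx0' : H x = 0 := hx0
  rcases lt_trichotomy x y with h | h | h
  · have := hA x ⟨hx.1, h⟩
    linarith
  · exact h
  · have := hB x ⟨h, hx.2⟩
    linarith
end

section
/- Let α ≥ 2 be a real number. Then H_α(x) < 0 for every x in the open interval (0, 2π/α). -/
/-- For `α ≥ 2`, the function `H_α(x) = sin (α x) - α sin x` is negative on `(0, 2π/α)`. -/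
theorem Halpha_neg_of_two_le (α : ℝ) (hα : 2 ≤ α) :
    ∀ x ∈ Set.Ioo (0 : ℝ) (2 * Real.pi / α), Real.sin (α * x) - α * Real.sin x < 0 := by
  rintro x ⟨hx0, hx1⟩
  have ha : 0 < α := by linarith
  have hax : α * x < 2 * Real.pi := by
    rw [lt_div_iff₀ ha] at hx1
    linarith
  have hpos : 0 < α * x := mul_pos ha hx0
  have hxpi : x < Real.pi := by nlinarith
  have hs : 0 < Real.sin x := Real.sin_pos_of_pos_of_lt_pi hx0 hxpi
  have has : 0 < α * Real.sin x := mul_pos ha hs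
  rcases le_or_gt Real.pi (α * x) with h | h
  · have h1 : 0 ≤ Real.sin (α * x - Real.pi) :=
      Real.sin_nonneg_of_nonneg_of_le_pi (by linarith) (by linarith)
    rw [Real.sin_sub_pi] at h1
    linarith
  · have h0 : (0 : ℝ) ∈ Set.Icc 0 Real.pi := ⟨le_rfl, Real.pi_pos.le⟩
    have h1 : α * x ∈ Set.Icc 0 Real.pi := ⟨hpos.le, h.le⟩
    have hb : 0 < 1 - 1 / α := by
      rw [sub_pos, div_lt_one ha]
      linarith
    have hb' : 0 < 1 / α := by positivity
    have hc := strictConcaveOn_sin_Icc.2 h0 h1 hpos.ne hb hb' (by ring)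
    have e : 1 / α * (α * x) = x := by field_simp
    simp only [smul_eq_mul, mul_zero, Real.sin_zero, zero_add, e] at hc
    rw [one_div, inv_mul_lt_iff₀ ha] at hc
    linarith
end

section
/- Let 1/2 < κ < 1 and let x ∈ (π/2, π) satisfy sin(2κx) = κ·sin(2x). Then tan(x)·cot(κx) < 1. -/
/-- For `1/2 < κ < 1` and `x ∈ (π/2, π)` with `sin (2κx) = κ sin (2x)`,
one has `F_κ(x) = tan x · cot (κ x) < 1`. -/
theorem Fkappa_lt_one_at_crit (κ x : ℝ) (hκ0 : 1 / 2 < κ) (hκ1 : κ < 1)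
    (hx : x ∈ Set.Ioo (Real.pi / 2) Real.pi)
    (hcrit : Real.sin (2 * κ * x) = κ * Real.sin (2 * x)) :
    Real.tan x * Real.cot (κ * x) < 1 := by
  obtain ⟨h1, h2⟩ := hx
  have hpi := Real.pi_pos
  have hx0 : 0 < x := by linarith
  have hk0 : 0 < κ * x := by apply mul_pos <;> linarith
  have hk1 : κ * x < x := by nlinarith
  have hc : Real.cos x < 0 := Real.cos_neg_of_pi_div_two_lt_of_lt h1 (by linarith)
  have hs : 0 < Real.sin (κ * x) := Real.sin_pos_of_pos_of_lt_pi hk0 (by linarith)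
  have hd : 0 < Real.sin (x - κ * x) :=
    Real.sin_pos_of_pos_of_lt_pi (by linarith) (by linarith)
  rw [Real.sin_sub] at hd
  rw [Real.tan_eq_sin_div_cos, Real.cot_eq_cos_div_sin, div_mul_div_comm,
    div_lt_one_of_neg (mul_neg_of_neg_of_pos hc hs)]
  linarith
end

section
/- Let 1 < κ < 2 and let x ∈ (π/2, π/κ) satisfy sin(2κx) = κ·sin(2x). Then tan(x)·cot(κx) > 1. -/
/-- For `1 < κ < 2` and `x ∈ (π/2, π/κ)` with `sin (2κx) = κ sin (2x)`,
one has `F_κ(x) = tan x · cot (κ x) > 1`. -/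
theorem Fkappa_gt_one_at_crit (κ x : ℝ) (hκ1 : 1 < κ) (hκ2 : κ < 2)
    (hx : x ∈ Set.Ioo (Real.pi / 2) (Real.pi / κ))
    (hcrit : Real.sin (2 * κ * x) = κ * Real.sin (2 * x)) :
    Real.tan x * Real.cot (κ * x) > 1 := by
  obtain ⟨h1, h2⟩ := hx
  have hpi := Real.pi_pos
  have hy : κ * x < Real.pi := by
    rw [lt_div_iff₀ (by linarith)] at h2
    linarith
  have hxy : x < κ * x := by nlinarith
  have hc : Real.cos x < 0 := Real.cos_neg_of_pi_div_two_lt_of_lt h1 (by linarith)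
  have hs : 0 < Real.sin (κ * x) := Real.sin_pos_of_pos_of_lt_pi (by linarith) hy
  have hd : 0 < Real.sin (κ * x - x) := Real.sin_pos_of_pos_of_lt_pi (by linarith) (by linarith)
  rw [Real.sin_sub] at hd
  rw [Real.tan_eq_sin_div_cos, Real.cot_eq_cos_div_sin, div_mul_div_comm, gt_iff_lt,
    one_lt_div_of_neg (mul_neg_of_neg_of_pos hc hs)]
  linarith
end

section
/- Let κ > 0 with either 0 < κ < 1/2 or κ > 1, let a ∈ ℝ, and set I₀ = (0, min(π, π/κ)). If a > G(κ), then there exists a unique φ* ∈ I₀ with b'(φ*) = 0, and b'(θ) > 0 for θ ∈ (0, φ*) while b'(θ) < 0 for θ ∈ (φ*, min(π, π/κ)). If a ≤ G(κ), then b'(θ) < 0 for every θ ∈ I₀. -/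
open Real Set Filter Topology

lemma q_anti (k c1 c2 q1 q2 : ℝ) (hk : 0 < k) (h1 : q1 ^ 2 + 2 * c1 * q1 = k)
    (h2 : q2 ^ 2 + 2 * c2 * q2 = k) (p1 : 0 < q1) (p2 : 0 < q2) (hc : c2 < c1) : q1 < q2 := by
  by_contra hcon
  push Not at hcon
  have e2 : 0 < q2 + 2 * c2 := by
    by_contra h
    push Not at h
    nlinarith
  nlinarith [mul_le_mul_of_nonneg_right hcon e2.le]

lemma concave_step (k v Z1 Z2 Z3 : ℝ) (h12 : Z1 < Z2) (h23 : Z2 < Z3)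
    (h1 : 0 ≤ Z1 * (k + 2 - Z1) - v * (k + Z1)) (h3 : 0 ≤ Z3 * (k + 2 - Z3) - v * (k + Z3)) :
    0 < Z2 * (k + 2 - Z2) - v * (k + Z2) := by
  have e : (Z3 - Z1) * (Z2 * (k + 2 - Z2) - v * (k + Z2)) =
      (Z3 - Z2) * (Z1 * (k + 2 - Z1) - v * (k + Z1)) + (Z2 - Z1) * (Z3 * (k + 2 - Z3) - v * (k + Z3))
      + (Z3 - Z2) * (Z2 - Z1) * (Z3 - Z1) := by ring
  have a1 : 0 < Z3 - Z2 := by linarith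
  have a2 : 0 < Z2 - Z1 := by linarith
  have a3 : 0 < Z3 - Z1 := by linarith
  have : 0 < (Z3 - Z1) * (Z2 * (k + 2 - Z2) - v * (k + Z2)) := by
    rw [e]; positivity
  exact (pos_iff_pos_of_mul_pos this).1 a3

noncomputable def qf (k x : ℝ) : ℝ := √(cos x ^ 2 + k) - cos x

lemma qf_pos (k x : ℝ) (hk : 0 < k) : 0 < qf k x := by
  unfold qf
  have : |cos x| < √(cos x ^ 2 + k) := by
    apply Real.lt_sqrt_of_sq_lt
    rw [sq_abs]; linarith
  linarith [le_abs_self (cos x)]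

lemma qf_eq (k x : ℝ) (hk : 0 < k) : qf k x ^ 2 + 2 * cos x * qf k x = k := by
  unfold qf
  have : √(cos x ^ 2 + k) ^ 2 = cos x ^ 2 + k := Real.sq_sqrt (by positivity)
  linear_combination this

lemma qf_unique (k x q : ℝ) (hk : 0 < k) (hq : 0 < q) (h : q ^ 2 + 2 * cos x * q = k) :
    qf k x = q := by
  have h1 := qf_eq k x hk
  have h2 := qf_pos k x hk
  have e : (qf k x - q) * (qf k x + q + 2 * cos x) = 0 := by linear_combination h1 - h
  have e2 : 0 < q + 2 * cos x := by
    by_contra hh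
    push Not at hh
    nlinarith
  rcases mul_eq_zero.1 e with h' | h'
  · linarith
  · linarith

lemma psi_deriv (k K x : ℝ) (hk : 0 < k) :
    HasDerivAt (fun x => x - K * (sin x * qf k x))
      (1 - K * (qf k x ^ 2 * (k + 2 - qf k x ^ 2) / (k + qf k x ^ 2))) x := by
  have hpos : 0 < cos x ^ 2 + k := by positivity
  have hs : HasDerivAt (fun x => √(cos x ^ 2 + k))
      ((2 * cos x * (-sin x)) / (2 * √(cos x ^ 2 + k))) x := by
    have := (((hasDerivAt_cos x).pow 2).add_const k).sqrt hpos.ne'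
    simpa using this
  have hq : HasDerivAt (qf k) ((2 * cos x * (-sin x)) / (2 * √(cos x ^ 2 + k)) - (- sin x)) x :=
    hs.sub (hasDerivAt_cos x)
  have := (hasDerivAt_id x).sub (((hasDerivAt_sin x).mul hq).const_mul K)
  refine this.congr_deriv ?_
  have hW : √(cos x ^ 2 + k) = qf k x + cos x := by unfold qf; ring
  rw [hW]
  have h1 := qf_eq k x hk
  have h2 := qf_pos k x hk
  have hWpos : 0 < qf k x + cos x := by rw [← hW]; exact Real.sqrt_pos.2 hpos
  generalize qf k x = q at *
  have hs2 : sin x ^ 2 = 1 - cos x ^ 2 := by linarith [sin_sq_add_cos_sq x]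
  have hden : k + q ^ 2 = 2 * q * (q + cos x) := by linear_combination -h1
  rw [hden]
  congr 2
  field_simp
  rw [hs2]
  subst h1
  ring

lemma D_qc (k K a b c : ℝ) (hk : 0 < k) (hK : 0 < K) (ha : 0 ≤ a) (hab : a < b) (hbc : b < c)
    (hc : c ≤ π)
    (h1 : 1 - K * (qf k a ^ 2 * (k + 2 - qf k a ^ 2) / (k + qf k a ^ 2)) ≤ 0)
    (h3 : 1 - K * (qf k c ^ 2 * (k + 2 - qf k c ^ 2) / (k + qf k c ^ 2)) ≤ 0) :
    1 - K * (qf k b ^ 2 * (k + 2 - qf k b ^ 2) / (k + qf k b ^ 2)) < 0 := by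
  have pa := qf_pos k a hk
  have pb := qf_pos k b hk
  have pc := qf_pos k c hk
  have lab := q_anti k _ _ _ _ hk (qf_eq k a hk) (qf_eq k b hk) pa pb
    (Real.cos_lt_cos_of_nonneg_of_le_pi ha (by linarith) hab)
  have lbc := q_anti k _ _ _ _ hk (qf_eq k b hk) (qf_eq k c hk) pb pc
    (Real.cos_lt_cos_of_nonneg_of_le_pi (by linarith) hc hbc)
  have conv : ∀ Z : ℝ, 0 < Z → 1 - K * (Z * (k + 2 - Z) / (k + Z)) =
      - (K / (k + Z)) * (Z * (k + 2 - Z) - (1 / K) * (k + Z)) := by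
    intro Z hZ
    have : k + Z ≠ 0 := by positivity
    field_simp
    ring
  rw [conv _ (by positivity)] at h1 h3 ⊢
  have f : ∀ Z : ℝ, 0 < Z → 0 < K / (k + Z) := fun Z hZ => by positivity
  have fa := f _ (pow_pos pa 2)
  have fb := f _ (pow_pos pb 2)
  have fc := f _ (pow_pos pc 2)
  have g1 : 0 ≤ qf k a ^ 2 * (k + 2 - qf k a ^ 2) - (1 / K) * (k + qf k a ^ 2) := by
    by_contra h; push Not at h; nlinarith
  have g3 : 0 ≤ qf k c ^ 2 * (k + 2 - qf k c ^ 2) - (1 / K) * (k + qf k c ^ 2) := by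
    by_contra h; push Not at h; nlinarith
  have g2 := concave_step k (1 / K) _ _ _ (pow_lt_pow_left₀ lab pa.le two_ne_zero)
    (pow_lt_pow_left₀ lbc pb.le two_ne_zero) g1 g3
  nlinarith [mul_pos fb g2]

lemma psi_pos (x y : ℝ) (hx : 0 < x) (hxp : x < π) (hy : 0 < y) (hyp : y < π / 2)
    (h : 2 * y < x ∨ x < y) :
    0 < x - (y / (2 * cos y * sin y)) * (sin x * qf (8 * cos y ^ 2) x) := by
  have hc : 0 < cos y := cos_pos_of_mem_Ioo ⟨by linarith, hyp⟩
  have hs : 0 < sin y := sin_pos_of_pos_of_lt_pi hy (by linarith [pi_pos])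
  set k := 8 * cos y ^ 2 with hkdef
  have hk : 0 < k := by positivity
  set K := y / (2 * cos y * sin y) with hKdef
  have hK : 0 < K := by positivity
  have hd := fun x => psi_deriv k K x hk
  have hcont : Continuous (fun x => x - K * (sin x * qf k x)) :=
    continuous_iff_continuousAt.2 fun x => (hd x).continuousAt
  have mvt : ∀ a b : ℝ, a < b → ∃ c ∈ Ioo a b,
      1 - K * (qf k c ^ 2 * (k + 2 - qf k c ^ 2) / (k + qf k c ^ 2)) =
      ((fun x => x - K * (sin x * qf k x)) b - (fun x => x - K * (sin x * qf k x)) a) / (b - a) :=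
    fun a b hab => exists_hasDerivAt_eq_slope (fun x => x - K * (sin x * qf k x)) _ hab hcont.continuousOn
      (fun x _ => hd x)
  have v0 : (fun x => x - K * (sin x * qf k x)) 0 = 0 := by simp
  have v1 : (fun x => x - K * (sin x * qf k x)) y = 0 := by
    have : qf k y = 2 * cos y := qf_unique k y _ hk (by positivity) (by rw [hkdef]; ring)
    simp only [this, hKdef]
    field_simp
    ring
  have v2 : (fun x => x - K * (sin x * qf k x)) (2 * y) = 0 := by
    have : qf k (2 * y) = 2 :=
      qf_unique k _ _ hk (by positivity) (by rw [hkdef, cos_two_mul]; ring)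
    simp only [this, hKdef, sin_two_mul]
    field_simp
    ring
  by_contra hcon
  push Not at hcon
  have vx : (fun x => x - K * (sin x * qf k x)) x ≤ 0 := hcon
  generalize (fun x => x - K * (sin x * qf k x)) = f at *
  rcases h with h | h
  · obtain ⟨a, ⟨ha0, ha1⟩, ha⟩ := mvt 0 y hy
    obtain ⟨b, ⟨hb0, hb1⟩, hb⟩ := mvt y (2 * y) (by linarith)
    obtain ⟨c, ⟨hc0, hc1⟩, hc⟩ := mvt (2 * y) x h
    rw [v0, v1] at ha
    rw [v1, v2] at hb
    rw [v2] at hc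
    have := D_qc k K a b c hk hK ha0.le (by linarith) (by linarith) (by linarith)
      (by rw [ha]; simp) (by rw [hc]; exact div_nonpos_of_nonpos_of_nonneg (by linarith) (by linarith))
    rw [hb] at this
    simp at this
  · obtain ⟨a, ⟨ha0, ha1⟩, ha⟩ := mvt 0 x hx
    obtain ⟨b, ⟨hb0, hb1⟩, hb⟩ := mvt x y h
    obtain ⟨c, ⟨hc0, hc1⟩, hc⟩ := mvt y (2 * y) (by linarith)
    rw [v0] at ha
    rw [v1] at hb
    rw [v1, v2] at hc
    have := D_qc k K a b c hk hK ha0.le (by linarith) (by linarith) (by linarith)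
      (by rw [ha]; exact div_nonpos_of_nonpos_of_nonneg (by linarith) (by linarith))
      (by rw [hc]; simp)
    rw [hb] at this
    have h2 : 0 ≤ (0 - f x) / (y - x) := div_nonneg (by linarith) (by linarith)
    linarith

lemma key (x y : ℝ) (hx : 0 < x) (hxp : x < π) (hy : 0 < y) (hyp : y < π)
    (h : 2 * y < x ∨ x < y) :
    0 < x ^ 2 * cos y * sin y ^ 2 + x * y * cos x * sin x * sin y
      - 2 * y ^ 2 * cos y * sin x ^ 2 := by
  have hsx : 0 < sin x := sin_pos_of_pos_of_lt_pi hx hxp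
  have hsy : 0 < sin y := sin_pos_of_pos_of_lt_pi hy hyp
  by_cases hy2 : y < π / 2
  · have hc : 0 < cos y := cos_pos_of_mem_Ioo ⟨by linarith, hy2⟩
    have hp := psi_pos x y hx hxp hy hy2 h
    have hk : 0 < 8 * cos y ^ 2 := by positivity
    have hq := qf_pos (8 * cos y ^ 2) x hk
    have he := qf_eq (8 * cos y ^ 2) x hk
    generalize qf (8 * cos y ^ 2) x = q at *
    have hX : 0 < (y / (2 * cos y * sin y)) * (sin x * q) := by positivity
    set X := (y / (2 * cos y * sin y)) * (sin x * q) with hXd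
    have hX2 : X * (2 * cos y * sin y) = y * sin x * q := by
      rw [hXd]; field_simp
    have r : X * (cos y * sin y ^ 2 * X + y * cos x * sin x * sin y) = 2 * y ^ 2 * cos y * sin x ^ 2 := by
      have : (4 * cos y) * (X * (cos y * sin y ^ 2 * X + y * cos x * sin x * sin y)) =
          (4 * cos y) * (2 * y ^ 2 * cos y * sin x ^ 2) := by
        linear_combination (X * (2 * cos y * sin y) + y * sin x * q + 2 * y * cos x * sin x) * hX2
          + y ^ 2 * sin x ^ 2 * he
      exact mul_left_cancel₀ (by positivity) this
    have r2 : 0 < cos y * sin y ^ 2 * X + y * cos x * sin x * sin y := by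
      have : 0 < X * (cos y * sin y ^ 2 * X + y * cos x * sin x * sin y) := by rw [r]; positivity
      exact (pos_iff_pos_of_mul_pos this).1 hX
    have : 0 < (x - X) * (cos y * sin y ^ 2 * x + (cos y * sin y ^ 2 * X + y * cos x * sin x * sin y)) :=
      mul_pos hp (by positivity)
    nlinarith
  · push Not at hy2
    have hxy : x < y := by
      rcases h with h | h
      · linarith
      · exact h
    have hcy : cos y ≤ 0 := cos_nonpos_of_pi_div_two_le_of_le hy2 (by linarith [pi_pos])
    have hcc : cos y < cos x := Real.cos_lt_cos_of_nonneg_of_le_pi hx.le hyp.le hxy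
    have hAB : x * sin y < y * sin x := by
      have h1 : 0 < 1 - x / y := by rw [sub_pos, div_lt_one hy]; exact hxy
      have h2 : 0 < x / y := by positivity
      have m0 : (0 : ℝ) ∈ Icc 0 π := ⟨le_refl _, pi_pos.le⟩
      have m1 : y ∈ Icc 0 π := ⟨hy.le, hyp.le⟩
      have := strictConcaveOn_sin_Icc.2 m0 m1 hy.ne h1 h2 (by ring)
      have e : x / y * y = x := by field_simp
      simp only [smul_eq_mul, sin_zero, mul_zero, zero_add, e] at this
      rw [div_mul_eq_mul_div, div_lt_iff₀ hy] at this
      linarith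
    have hB : 0 < x * sin y := by positivity
    have hA : 0 < y * sin x := by positivity
    have e : x ^ 2 * cos y * sin y ^ 2 + x * y * cos x * sin x * sin y - 2 * y ^ 2 * cos y * sin x ^ 2
      = (-cos y) * ((2 * (y * sin x) + x * sin y) * (y * sin x - x * sin y))
        + (cos x - cos y) * ((y * sin x) * (x * sin y)) := by ring
    rw [e]
    have t1 : 0 < (cos x - cos y) * ((y * sin x) * (x * sin y)) :=
      mul_pos (by linarith) (mul_pos hA hB)
    have t2 : 0 ≤ (-cos y) * ((2 * (y * sin x) + x * sin y) * (y * sin x - x * sin y)) :=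
      mul_nonneg (by linarith) (mul_nonneg (by linarith) (by linarith))
    linarith

noncomputable def Hf (κ θ : ℝ) : ℝ :=
  κ / sin (κ * θ) ^ 2 - cos θ * cos (κ * θ) / (sin θ * sin (κ * θ))

lemma Hf_deriv (κ θ : ℝ) (h1 : sin θ ≠ 0) (h2 : sin (κ * θ) ≠ 0) :
    HasDerivAt (Hf κ) ((cos (κ * θ) * sin (κ * θ) ^ 2 + κ * cos θ * sin θ * sin (κ * θ)
      - 2 * κ ^ 2 * cos (κ * θ) * sin θ ^ 2) / (sin θ ^ 2 * sin (κ * θ) ^ 3)) θ := by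
  have hl : HasDerivAt (fun θ => κ * θ) κ θ := by simpa using (hasDerivAt_id θ).const_mul κ
  have hs := hl.sin
  have hc := hl.cos
  have := ((hasDerivAt_const θ κ).div (hs.pow 2) (pow_ne_zero 2 h2)).sub
    (((hasDerivAt_cos θ).mul hc).div ((hasDerivAt_sin θ).mul hs) (mul_ne_zero h1 h2))
  refine this.congr_deriv ?_
  simp only [Pi.pow_apply, Pi.mul_apply]
  have e1 : cos θ ^ 2 = 1 - sin θ ^ 2 := by linarith [sin_sq_add_cos_sq θ]
  have e2 : cos (κ * θ) ^ 2 = 1 - sin (κ * θ) ^ 2 := by linarith [sin_sq_add_cos_sq (κ * θ)]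
  generalize sin (κ * θ) = S at *
  generalize cos (κ * θ) = C at *
  field_simp
  ring_nf
  simp only [e1, e2]
  ring

lemma mem_I (κ : ℝ) (hκ : 0 < κ) (θ : ℝ) (h : θ ∈ Ioo (0 : ℝ) (min π (π / κ))) :
    0 < θ ∧ θ < π ∧ 0 < κ * θ ∧ κ * θ < π := by
  obtain ⟨h0, h1⟩ := h
  rw [lt_min_iff, lt_div_iff₀ hκ] at h1
  exact ⟨h0, h1.1, by positivity, by linarith [h1.2]⟩

lemma Hf_mono (κ : ℝ) (hκ : (0 < κ ∧ κ < 1 / 2) ∨ 1 < κ) :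
    StrictMonoOn (Hf κ) (Ioo (0 : ℝ) (min π (π / κ))) := by
  have hκ0 : 0 < κ := by rcases hκ with h | h <;> linarith
  have hd : ∀ θ ∈ Ioo (0 : ℝ) (min π (π / κ)), _ := fun θ hθ =>
    have h := mem_I κ hκ0 θ hθ
    Hf_deriv κ θ (sin_pos_of_pos_of_lt_pi h.1 h.2.1).ne' (sin_pos_of_pos_of_lt_pi h.2.2.1 h.2.2.2).ne'
  apply strictMonoOn_of_deriv_pos (convex_Ioo _ _)
  · exact fun θ hθ => (hd θ hθ).continuousAt.continuousWithinAt
  · intro θ hθ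
    rw [interior_Ioo] at hθ
    rw [(hd θ hθ).deriv]
    obtain ⟨a1, a2, a3, a4⟩ := mem_I κ hκ0 θ hθ
    have s1 := sin_pos_of_pos_of_lt_pi a1 a2
    have s2 := sin_pos_of_pos_of_lt_pi a3 a4
    have := key θ (κ * θ) a1 a2 a3 a4 (by
      rcases hκ with h | h
      · left; nlinarith
      · right; nlinarith)
    apply div_pos _ (by positivity)
    have e : θ ^ 2 * cos (κ * θ) * sin (κ * θ) ^ 2 + θ * (κ * θ) * cos θ * sin θ * sin (κ * θ)
      - 2 * (κ * θ) ^ 2 * cos (κ * θ) * sin θ ^ 2 = θ ^ 2 * (cos (κ * θ) * sin (κ * θ) ^ 2 + κ * cos θ * sin θ * sin (κ * θ)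
      - 2 * κ ^ 2 * cos (κ * θ) * sin θ ^ 2) := by ring
    rw [e] at this
    exact (pos_iff_pos_of_mul_pos this).1 (by positivity)

lemma tendsto_p : Tendsto (fun x : ℝ => (x - sin x) / x ^ 3) (𝓝[>] 0) (𝓝 (1 / 6)) := by
  rw [← tendsto_sub_nhds_zero_iff]
  have hz : Tendsto (fun x : ℝ => x * (5 / 96)) (𝓝[>] 0) (𝓝 0) := by
    have : Tendsto (fun x : ℝ => x * (5 / 96)) (𝓝 0) (𝓝 (0 * (5 / 96))) :=
      (continuous_id.mul continuous_const).tendsto 0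
    rw [zero_mul] at this
    exact this.mono_left nhdsWithin_le_nhds
  refine squeeze_zero_norm' ?_ hz
  filter_upwards [Ioo_mem_nhdsGT (zero_lt_one' ℝ)] with x hx
  have := Real.sin_bound (x := x) (by rw [abs_of_pos hx.1]; exact hx.2.le)
  have hx0 := hx.1
  rw [abs_of_pos hx0] at this
  have e : (x - sin x) / x ^ 3 - 1 / 6 = - (sin x - (x - x ^ 3 / 6)) / x ^ 3 := by field_simp; ring
  rw [e, Real.norm_eq_abs, abs_div, abs_neg, abs_of_pos (pow_pos hx0 3), div_le_iff₀ (by positivity)]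
  have h5 : x ^ 5 ≤ x ^ 4 := pow_le_pow_of_le_one hx0.le hx.2.le (by norm_num)
  nlinarith [pow_pos hx0 4]

lemma tendsto_r : Tendsto (fun x : ℝ => (1 - cos x) / x ^ 2) (𝓝[>] 0) (𝓝 (1 / 2)) := by
  rw [← tendsto_sub_nhds_zero_iff]
  have hz : Tendsto (fun x : ℝ => x ^ 2 * (5 / 96)) (𝓝[>] 0) (𝓝 0) := by
    have : Tendsto (fun x : ℝ => x ^ 2 * (5 / 96)) (𝓝 0) (𝓝 (0 ^ 2 * (5 / 96))) :=
      ((continuous_id.pow 2).mul continuous_const).tendsto 0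
    norm_num at this
    exact this.mono_left nhdsWithin_le_nhds
  refine squeeze_zero_norm' ?_ hz
  filter_upwards [Ioo_mem_nhdsGT (zero_lt_one' ℝ)] with x hx
  have := Real.cos_bound (x := x) (by rw [abs_of_pos hx.1]; exact hx.2.le)
  have hx0 := hx.1
  rw [abs_of_pos hx0] at this
  have e : (1 - cos x) / x ^ 2 - 1 / 2 = - (cos x - (1 - x ^ 2 / 2)) / x ^ 2 := by field_simp; ring
  rw [e, Real.norm_eq_abs, abs_div, abs_neg, abs_of_pos (pow_pos hx0 2), div_le_iff₀ (by positivity)]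
  linarith

lemma Hf_tendsto (κ : ℝ) (hκ0 : 0 < κ) :
    Tendsto (Hf κ) (𝓝[>] 0) (𝓝 (2 * ((2 * κ ^ 2 + 3 * κ + 1) / (6 * κ)) - 1)) := by
  have scale : ∀ c : ℝ, 0 < c → Tendsto (fun x : ℝ => c * x) (𝓝[>] 0) (𝓝[>] 0) := by
    intro c hc
    apply tendsto_nhdsWithin_of_tendsto_nhds_of_eventually_within
    · have : Tendsto (fun x : ℝ => c * x) (𝓝 0) (𝓝 (c * 0)) :=
        (continuous_const.mul continuous_id).tendsto 0
      rw [mul_zero] at this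
      exact this.mono_left nhdsWithin_le_nhds
    · filter_upwards [self_mem_nhdsWithin] with x hx
      exact mul_pos hc hx
  have hid : Tendsto (fun x : ℝ => x) (𝓝[>] 0) (𝓝 0) := tendsto_id.mono_left nhdsWithin_le_nhds
  have p1 := tendsto_p
  have p2 := tendsto_p.comp (scale (2 * κ) (by positivity))
  have r1 := tendsto_r
  have sl : Tendsto (fun x : ℝ => sin x / x) (𝓝[>] 0) (𝓝 1) := by
    have : Tendsto (fun x : ℝ => 1 - x ^ 2 * ((x - sin x) / x ^ 3)) (𝓝[>] 0) (𝓝 (1 - 0 ^ 2 * (1 / 6))) :=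
      tendsto_const_nhds.sub ((hid.pow 2).mul p1)
    norm_num at this
    refine this.congr' ?_
    filter_upwards [self_mem_nhdsWithin] with x hx
    have hx0 : (0 : ℝ) < x := hx
    field_simp
    ring
  have sl2 := sl.comp (scale κ hκ0)
  have num := (((p1.const_mul (-κ)).add (p2.const_mul (4 * κ ^ 3))).add (r1.const_mul κ)).sub
    (((hid.pow 2).mul (r1.mul p2)).const_mul (4 * κ ^ 3))
  have den := (sl.mul (sl2.pow 2)).const_mul (κ ^ 2)
  have tot := num.div den (by positivity)
  have e : (-κ * (1 / 6) + 4 * κ ^ 3 * (1 / 6) + κ * (1 / 2) - 4 * κ ^ 3 * (0 ^ 2 * (1 / 2 * (1 / 6)))) / (κ ^ 2 * (1 * 1 ^ 2)) = 2 * ((2 * κ ^ 2 + 3 * κ + 1) / (6 * κ)) - 1 := by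
    field_simp; ring
  rw [e] at tot
  refine tot.congr' ?_
  have hm : (0 : ℝ) < min π (π / κ) := lt_min pi_pos (by positivity)
  filter_upwards [Ioo_mem_nhdsGT hm] with x hx
  obtain ⟨a1, a2, a3, a4⟩ := mem_I κ hκ0 x hx
  have s1 := sin_pos_of_pos_of_lt_pi a1 a2
  have s2 := sin_pos_of_pos_of_lt_pi a3 a4
  have e3 : sin (2 * κ * x) = 2 * sin (κ * x) * cos (κ * x) := by
    rw [mul_assoc, sin_two_mul]
  simp only [Function.comp, Pi.div_apply, Hf, e3]
  generalize sin (κ * x) = S at *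
  generalize cos (κ * x) = C at *
  field_simp
  ring

lemma b_deriv (κ a θ : ℝ) (h1 : sin θ ≠ 0) (h2 : sin (κ * θ) ≠ 0) :
    deriv (fun θ => (1 - 2 * a) * cos θ + sin θ * cot (κ * θ)) θ
      = sin θ * ((2 * a - 1) - Hf κ θ) := by
  have hl : HasDerivAt (fun θ => κ * θ) κ θ := by simpa using (hasDerivAt_id θ).const_mul κ
  have := ((hasDerivAt_cos θ).const_mul (1 - 2 * a)).add
    ((hasDerivAt_sin θ).mul (hl.cos.div hl.sin h2))
  have e : (fun θ => (1 - 2 * a) * cos θ + sin θ * cot (κ * θ)) =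
      (fun θ => (1 - 2 * a) * cos θ) + (sin * ((fun θ => cos (κ * θ)) / fun θ => sin (κ * θ))) := by
    funext t
    simp [Real.cot_eq_cos_div_sin]
  rw [e]
  refine HasDerivAt.deriv (this.congr_deriv ?_)
  simp only [Pi.div_apply, Hf]
  have e2 : cos (κ * θ) ^ 2 = 1 - sin (κ * θ) ^ 2 := by linarith [sin_sq_add_cos_sq (κ * θ)]
  generalize sin (κ * θ) = S at *
  generalize cos (κ * θ) = C at *
  field_simp
  ring_nf
  simp only [e2]
  ring

lemma exists_right (κ v : ℝ) (hκ : (0 < κ ∧ κ < 1 / 2) ∨ 1 < κ) :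
    ∃ θ ∈ Ioo (0 : ℝ) (min π (π / κ)), v < Hf κ θ := by
  have hκ0 : 0 < κ := by rcases hκ with h | h <;> linarith
  have hm : (0 : ℝ) < min π (π / κ) := lt_min pi_pos (by positivity)
  set J : ℝ → ℝ := fun θ => v * sin θ * sin (κ * θ) ^ 2 + cos θ * cos (κ * θ) * sin (κ * θ)
    - κ * sin θ with hJ
  have hJc : Continuous J := by fun_prop
  have hJm : J (min π (π / κ)) < 0 := by
    rcases hκ with h | h
    · have : min π (π / κ) = π := min_eq_left (by
        rw [le_div_iff₀ hκ0]; nlinarith [pi_pos])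
      rw [this]
      have c1 : 0 < cos (κ * π) := cos_pos_of_mem_Ioo ⟨by nlinarith [pi_pos], by nlinarith [pi_pos]⟩
      have c2 : 0 < sin (κ * π) := sin_pos_of_pos_of_lt_pi (by positivity) (by nlinarith [pi_pos])
      simp [hJ]
      positivity
    · have : min π (π / κ) = π / κ := min_eq_right (by
        rw [div_le_iff₀ hκ0]; nlinarith [pi_pos])
      rw [this]
      have c2 : 0 < sin (π / κ) := sin_pos_of_pos_of_lt_pi (by positivity) (by
        rw [div_lt_iff₀ hκ0]; nlinarith [pi_pos])
      have : κ * (π / κ) = π := by field_simp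
      simp [hJ, this]
      positivity
  have ev : ∀ᶠ θ in 𝓝[<] (min π (π / κ)), J θ < 0 :=
    nhdsWithin_le_nhds (hJc.tendsto _ (Iio_mem_nhds hJm))
  obtain ⟨θ, h1, h2⟩ := (ev.and (Ioo_mem_nhdsLT hm)).exists
  refine ⟨θ, h2, ?_⟩
  obtain ⟨a1, a2, a3, a4⟩ := mem_I κ hκ0 θ h2
  have s1 := sin_pos_of_pos_of_lt_pi a1 a2
  have s2 := sin_pos_of_pos_of_lt_pi a3 a4
  have e : J θ = (sin θ * sin (κ * θ) ^ 2) * (v - Hf κ θ) := by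
    simp only [hJ, Hf]
    field_simp
    ring
  rw [e] at h1
  have : 0 < sin θ * sin (κ * θ) ^ 2 := by positivity
  by_contra hc
  push Not at hc
  nlinarith [mul_nonneg this.le (sub_nonneg.2 hc)]


/-- Sign behaviour of `b'(θ)` on `I₀ = (0, min π (π/κ))` for `0 < κ < 1/2` or `κ > 1`,
where `b(θ) = (1 - 2a) cos θ + sin θ · cot (κθ)` and `G(κ) = (2κ² + 3κ + 1)/(6κ)`. -/
theorem deriv_b_sign_of_small_or_large_kappa (κ a : ℝ)
    (hκ : (0 < κ ∧ κ < 1 / 2) ∨ 1 < κ) :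
    let b : ℝ → ℝ := fun θ => (1 - 2 * a) * Real.cos θ + Real.sin θ * Real.cot (κ * θ)
    let G : ℝ → ℝ := fun x => (2 * x ^ 2 + 3 * x + 1) / (6 * x)
    let m : ℝ := min Real.pi (Real.pi / κ)
    (a > G κ →
      ∃ φ ∈ Set.Ioo (0 : ℝ) m, deriv b φ = 0 ∧
        (∀ θ ∈ Set.Ioo (0 : ℝ) φ, deriv b θ > 0) ∧
        (∀ θ ∈ Set.Ioo φ m, deriv b θ < 0) ∧
        (∀ ψ ∈ Set.Ioo (0 : ℝ) m, deriv b ψ = 0 → ψ = φ)) ∧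
    (a ≤ G κ → ∀ θ ∈ Set.Ioo (0 : ℝ) m, deriv b θ < 0) := by
  intro b G m
  have hκ0 : 0 < κ := by rcases hκ with h | h <;> linarith
  have hm : (0 : ℝ) < m := lt_min pi_pos (by positivity)
  have hmono : StrictMonoOn (Hf κ) (Ioo 0 m) := Hf_mono κ hκ
  have hlim : Tendsto (Hf κ) (𝓝[>] 0) (𝓝 (2 * G κ - 1)) := Hf_tendsto κ hκ0
  have hs : ∀ θ ∈ Ioo (0 : ℝ) m, 0 < sin θ ∧ 0 < sin (κ * θ) := fun θ hθ =>
    have h := mem_I κ hκ0 θ hθ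
    ⟨sin_pos_of_pos_of_lt_pi h.1 h.2.1, sin_pos_of_pos_of_lt_pi h.2.2.1 h.2.2.2⟩
  have hb : ∀ θ ∈ Ioo (0 : ℝ) m, deriv b θ = sin θ * ((2 * a - 1) - Hf κ θ) := fun θ hθ =>
    b_deriv κ a θ (hs θ hθ).1.ne' (hs θ hθ).2.ne'
  refine ⟨?_, ?_⟩
  · intro ha
    have hlt : 2 * G κ - 1 < 2 * a - 1 := by linarith
    obtain ⟨l, hl1, hl⟩ := ((hlim.eventually (Iio_mem_nhds hlt)).and (Ioo_mem_nhdsGT hm)).exists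
    have hl1 : Hf κ l < 2 * a - 1 := hl1
    obtain ⟨r, hr, hr1⟩ := exists_right κ (2 * a - 1) hκ
    have hlr : l < r := (hmono.lt_iff_lt hl hr).1 (hl1.trans hr1)
    have hcont : ContinuousOn (Hf κ) (Icc l r) := fun θ hθ => by
      have := hs θ ⟨hl.1.trans_le hθ.1, hθ.2.trans_lt hr.2⟩
      exact (Hf_deriv κ θ this.1.ne' this.2.ne').continuousAt.continuousWithinAt
    obtain ⟨φ, hφ, hφe⟩ := intermediate_value_Icc hlr.le hcont ⟨hl1.le, hr1.le⟩
    have hφm : φ ∈ Ioo (0 : ℝ) m := ⟨hl.1.trans_le hφ.1, hφ.2.trans_lt hr.2⟩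
    refine ⟨φ, hφm, ?_, ?_, ?_, ?_⟩
    · rw [hb φ hφm, hφe]; ring
    · intro θ hθ
      have hθm : θ ∈ Ioo (0 : ℝ) m := ⟨hθ.1, hθ.2.trans hφm.2⟩
      rw [hb θ hθm]
      have := hmono hθm hφm hθ.2
      exact mul_pos (hs θ hθm).1 (by linarith)
    · intro θ hθ
      have hθm : θ ∈ Ioo (0 : ℝ) m := ⟨hφm.1.trans hθ.1, hθ.2⟩
      rw [hb θ hθm]
      have := hmono hφm hθm hθ.1
      exact mul_neg_of_pos_of_neg (hs θ hθm).1 (by linarith)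
    · intro ψ hψ h0
      rw [hb ψ hψ] at h0
      rcases mul_eq_zero.1 h0 with h | h
      · exact absurd h (hs ψ hψ).1.ne'
      · exact hmono.injOn hψ hφm (by linarith)
  · intro ha θ hθ
    rw [hb θ hθ]
    have h2 : θ / 2 ∈ Ioo (0 : ℝ) m := ⟨by linarith [hθ.1], by linarith [hθ.1, hθ.2]⟩
    have h3 := hmono h2 hθ (by linarith [hθ.1])
    have h4 : 2 * G κ - 1 ≤ Hf κ (θ / 2) := by
      refine le_of_tendsto hlim ?_
      filter_upwards [Ioo_mem_nhdsGT h2.1] with t ht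
      exact (hmono ⟨ht.1, ht.2.trans h2.2⟩ h2 ht.2).le
    exact mul_neg_of_pos_of_neg (hs θ hθ).1 (by linarith)
end

section
/- Let 1/2 < κ < 1, let a ∈ ℝ, and set I₀ = (0, π). If a < G(κ), then there exists a unique φ* ∈ I₀ with b'(φ*) = 0, and b'(θ) < 0 for θ ∈ (0, φ*) while b'(θ) > 0 for θ ∈ (φ*, π). If a ≥ G(κ), then b'(θ) > 0 for every θ ∈ I₀. -/
open Filter Topology

namespace MidKappa

/-- The function `4 P`, where `P = h' · sin² θ · sin³ κθ`. -/
noncomputable def Q0 (κ s : ℝ) : ℝ := (4*κ^2-1) * Real.cos (κ*s) + Real.cos (3*κ*s)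
  - κ*(2*κ-1) * Real.cos ((2+κ)*s) - κ*(2*κ+1) * Real.cos ((2-κ)*s)

noncomputable def Q1 (κ s : ℝ) : ℝ := -((4*κ^2-1)*κ * Real.sin (κ*s)) - 3*κ * Real.sin (3*κ*s)
  + κ*(2*κ-1)*(2+κ) * Real.sin ((2+κ)*s) + κ*(2*κ+1)*(2-κ) * Real.sin ((2-κ)*s)

noncomputable def Q2 (κ s : ℝ) : ℝ :=
  -((4*κ^2-1)*κ^2 * Real.cos (κ*s)) - 9*κ^2 * Real.cos (3*κ*s)
  + κ*(2*κ-1)*(2+κ)^2 * Real.cos ((2+κ)*s) + κ*(2*κ+1)*(2-κ)^2 * Real.cos ((2-κ)*s)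

noncomputable def Q3 (κ s : ℝ) : ℝ :=
  ((4*κ^2-1)*κ^3 * Real.sin (κ*s)) + 27*κ^3 * Real.sin (3*κ*s)
  - κ*(2*κ-1)*(2+κ)^3 * Real.sin ((2+κ)*s) - κ*(2*κ+1)*(2-κ)^3 * Real.sin ((2-κ)*s)

lemma hasDerivAt_cos_lin (c s : ℝ) :
    HasDerivAt (fun s => Real.cos (c*s)) (-(c * Real.sin (c*s))) s := by
  have h := ((hasDerivAt_id s).const_mul c).cos
  refine HasDerivAt.congr_deriv h ?_
  simp only [id]; ring

lemma hasDerivAt_sin_lin (c s : ℝ) :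
    HasDerivAt (fun s => Real.sin (c*s)) (c * Real.cos (c*s)) s := by
  have h := ((hasDerivAt_id s).const_mul c).sin
  refine HasDerivAt.congr_deriv h ?_
  simp only [id]; ring

lemma hQ0 (κ s : ℝ) : HasDerivAt (Q0 κ) (Q1 κ s) s := by
  have h := ((((hasDerivAt_cos_lin κ s).const_mul (4*κ^2-1)).add
    (hasDerivAt_cos_lin (3*κ) s)).sub ((hasDerivAt_cos_lin (2+κ) s).const_mul (κ*(2*κ-1)))).sub
    ((hasDerivAt_cos_lin (2-κ) s).const_mul (κ*(2*κ+1)))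
  refine HasDerivAt.congr_deriv h ?_
  unfold Q1; ring

lemma hQ1 (κ s : ℝ) : HasDerivAt (Q1 κ) (Q2 κ s) s := by
  have h := (((((hasDerivAt_sin_lin κ s).const_mul ((4*κ^2-1)*κ)).neg).sub
    ((hasDerivAt_sin_lin (3*κ) s).const_mul (3*κ))).add
    ((hasDerivAt_sin_lin (2+κ) s).const_mul (κ*(2*κ-1)*(2+κ)))).add
    ((hasDerivAt_sin_lin (2-κ) s).const_mul (κ*(2*κ+1)*(2-κ)))
  refine HasDerivAt.congr_deriv h ?_
  unfold Q2; ring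

lemma hQ2 (κ s : ℝ) : HasDerivAt (Q2 κ) (Q3 κ s) s := by
  have h := (((((hasDerivAt_cos_lin κ s).const_mul ((4*κ^2-1)*κ^2)).neg).sub
    ((hasDerivAt_cos_lin (3*κ) s).const_mul (9*κ^2))).add
    ((hasDerivAt_cos_lin (2+κ) s).const_mul (κ*(2*κ-1)*(2+κ)^2))).add
    ((hasDerivAt_cos_lin (2-κ) s).const_mul (κ*(2*κ+1)*(2-κ)^2))
  refine HasDerivAt.congr_deriv h ?_
  unfold Q3; ring

lemma cos_diff (κ s : ℝ) : Real.cos ((2-κ)*s) - Real.cos ((2+κ)*s)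
    = 2 * (Real.sin (2*s) * Real.sin (κ*s)) := by
  rw [show (2-κ)*s = 2*s - κ*s by ring, show (2+κ)*s = 2*s+κ*s by ring, Real.cos_sub, Real.cos_add]
  ring

lemma hQ3 (κ s : ℝ) : HasDerivAt (Q3 κ)
    (32*κ*(4*κ^2-1)*(1-κ^2) * (Real.sin (2*s) * Real.sin (κ*s)) - 10*κ^2 * Q2 κ s
      - 9*κ^4 * Q0 κ s) s := by
  have h := (((((hasDerivAt_sin_lin κ s).const_mul ((4*κ^2-1)*κ^3))).add
    ((hasDerivAt_sin_lin (3*κ) s).const_mul (27*κ^3))).sub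
    ((hasDerivAt_sin_lin (2+κ) s).const_mul (κ*(2*κ-1)*(2+κ)^3))).sub
    ((hasDerivAt_sin_lin (2-κ) s).const_mul (κ*(2*κ+1)*(2-κ)^3))
  refine HasDerivAt.congr_deriv h ?_
  unfold Q2 Q0
  linear_combination (16*κ*(4*κ^2-1)*(1-κ^2)) * cos_diff κ s

/-- Green's bilinear form, with `y = κ (θ - s)`. -/
noncomputable def E (κ θ s : ℝ) : ℝ :=
  (3 * Real.sin (κ*(θ-s)) - Real.sin (3*κ*(θ-s))) * (Q3 κ s + 10*κ^2 * Q1 κ s)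
  + κ*(3 * Real.cos (κ*(θ-s)) - 3*Real.cos (3*κ*(θ-s))) * (Q2 κ s + 10*κ^2 * Q0 κ s)
  + κ^2*(-3 * Real.sin (κ*(θ-s)) + 9*Real.sin (3*κ*(θ-s))) * Q1 κ s
  + κ^3*(-3 * Real.cos (κ*(θ-s)) + 27*Real.cos (3*κ*(θ-s))) * Q0 κ s

lemma hsinr (c θ s : ℝ) :
    HasDerivAt (fun s => Real.sin (c*(θ-s))) (-(c * Real.cos (c*(θ-s)))) s := by
  have h := (((hasDerivAt_id s).const_sub θ).const_mul c).sin
  refine HasDerivAt.congr_deriv h ?_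
  simp only [id]; ring

lemma hcosr (c θ s : ℝ) :
    HasDerivAt (fun s => Real.cos (c*(θ-s))) (c * Real.sin (c*(θ-s))) s := by
  have h := (((hasDerivAt_id s).const_sub θ).const_mul c).cos
  refine HasDerivAt.congr_deriv h ?_
  simp only [id]; ring

noncomputable def W (κ θ s : ℝ) : ℝ := Real.sin (κ*(θ-s))^3 * Real.sin (κ*s)

lemma hE (κ θ s : ℝ) : HasDerivAt (E κ θ)
    (128*κ*(4*κ^2-1)*(1-κ^2) * (W κ θ s * Real.sin (2*s))) s := by
  have h0 := ((hsinr κ θ s).const_mul 3).sub (hsinr (3*κ) θ s)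
  have h1 := (((hcosr κ θ s).const_mul 3).sub ((hcosr (3*κ) θ s).const_mul 3)).const_mul κ
  have h2 := (((hsinr κ θ s).const_mul (-3)).add ((hsinr (3*κ) θ s).const_mul 9)).const_mul (κ^2)
  have h3 := (((hcosr κ θ s).const_mul (-3)).add ((hcosr (3*κ) θ s).const_mul 27)).const_mul (κ^3)
  have h := (((h0.mul ((hQ3 κ s).add ((hQ1 κ s).const_mul (10*κ^2)))).add
    (h1.mul ((hQ2 κ s).add ((hQ0 κ s).const_mul (10*κ^2))))).add
    (h2.mul (hQ1 κ s))).add (h3.mul (hQ0 κ s))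
  refine HasDerivAt.congr_deriv h ?_
  have h3 : Real.sin (3*κ*(θ-s)) = 3 * Real.sin (κ*(θ-s)) - 4 * Real.sin (κ*(θ-s))^3 := by
    rw [← Real.sin_three_mul]; ring_nf
  simp only [Pi.add_apply, Pi.sub_apply, Pi.mul_apply, W, h3]
  ring

lemma E_zero (κ θ : ℝ) : E κ θ 0 = 0 := by
  simp [E, Q0, Q1, Q2, Q3]; ring

lemma E_self (κ θ : ℝ) : E κ θ θ = 24*κ^3 * Q0 κ θ := by
  simp only [E, sub_self, mul_zero, Real.sin_zero, Real.cos_zero]; ring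

lemma W_le {κ θ s : ℝ} (h0 : 0 < κ) (h1 : κ < 1) (hθ : θ < Real.pi) (hs : Real.pi - θ ≤ s)
    (hs2 : s ≤ Real.pi/2) : W κ θ (Real.pi - s) ≤ W κ θ s := by
  have hpi := Real.pi_pos
  have k1 : 0 ≤ Real.sin (κ*(θ-(Real.pi-s))) := by
    apply Real.sin_nonneg_of_nonneg_of_le_pi
    · apply mul_nonneg h0.le; linarith
    · nlinarith
  have k2 : Real.sin (κ*(θ-(Real.pi-s))) ≤ Real.sin (κ*(θ-s)) := by
    have : 0 ≤ Real.sin (κ*(θ-s)) - Real.sin (κ*(θ-(Real.pi-s))) := by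
      rw [Real.sin_sub_sin]
      apply mul_nonneg
      · apply mul_nonneg (by norm_num)
        apply Real.sin_nonneg_of_nonneg_of_le_pi
        · have : 0 ≤ κ * (Real.pi - 2*s) := mul_nonneg h0.le (by linarith)
          nlinarith
        · nlinarith
      · apply Real.cos_nonneg_of_neg_pi_div_two_le_of_le
        · have : 0 ≤ κ * (2*θ - Real.pi) := mul_nonneg h0.le (by linarith)
          nlinarith
        · nlinarith
    linarith
  have k3 : Real.sin (κ*(θ-(Real.pi-s))) * Real.sin (κ*(Real.pi-s))
      ≤ Real.sin (κ*(θ-s)) * Real.sin (κ*s) := by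
    have e1 := Real.cos_sub (κ*(θ-s)) (κ*s)
    have e2 := Real.cos_add (κ*(θ-s)) (κ*s)
    have e3 := Real.cos_sub (κ*(Real.pi-s)) (κ*(θ-(Real.pi-s)))
    have e4 := Real.cos_add (κ*(Real.pi-s)) (κ*(θ-(Real.pi-s)))
    rw [show κ*(Real.pi-s) + κ*(θ-(Real.pi-s)) = κ*(θ-s) + κ*s by ring] at e4
    have : Real.cos (κ*(Real.pi-s) - κ*(θ-(Real.pi-s))) ≤ Real.cos (κ*(θ-s) - κ*s) := by
      rw [← Real.cos_abs (κ*(θ-s) - κ*s)]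
      apply Real.cos_le_cos_of_nonneg_of_le_pi (abs_nonneg _)
      · nlinarith
      · rw [abs_le]
        constructor
        · have : 0 ≤ κ * (Real.pi - 2*s) := mul_nonneg h0.le (by linarith)
          nlinarith
        · have : 0 ≤ κ * (Real.pi - θ) := mul_nonneg h0.le (by linarith)
          nlinarith
    linarith
  have k4 : Real.sin (κ*(θ-(Real.pi-s)))^2 ≤ Real.sin (κ*(θ-s))^2 := by gcongr
  have k5 : 0 ≤ Real.sin (κ*(Real.pi-s)) := by
    apply Real.sin_nonneg_of_nonneg_of_le_pi
    · apply mul_nonneg h0.le; linarith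
    · nlinarith
  have := mul_le_mul k4 k3 (mul_nonneg k1 k5) (sq_nonneg _)
  unfold W
  nlinarith

lemma K_pos {κ : ℝ} (h0 : 1/2 < κ) (h1 : κ < 1) : 0 < 128*κ*(4*κ^2-1)*(1-κ^2) := by
  have a1 : 0 < 4*κ^2-1 := by nlinarith
  have a2 : 0 < 1-κ^2 := by nlinarith
  positivity

lemma E_pos {κ θ t : ℝ} (h0 : 1/2 < κ) (h1 : κ < 1) (ht : 0 < t) (ht2 : t ≤ Real.pi/2)
    (htθ : t ≤ θ) (hθ : θ < Real.pi) : 0 < E κ θ t := by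
  have hm : StrictMonoOn (E κ θ) (Set.Icc 0 t) := by
    apply strictMonoOn_of_deriv_pos (convex_Icc 0 t)
    · exact fun x _ => (hE κ θ x).continuousAt.continuousWithinAt
    · intro x hx
      rw [interior_Icc] at hx
      obtain ⟨hx0, hx1⟩ := hx
      rw [(hE κ θ x).deriv]
      apply mul_pos (K_pos h0 h1)
      apply mul_pos
      · unfold W
        apply mul_pos
        · apply pow_pos
          apply Real.sin_pos_of_pos_of_lt_pi
          · apply mul_pos <;> linarith
          · nlinarith
        · apply Real.sin_pos_of_pos_of_lt_pi
          · apply mul_pos <;> linarith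
          · nlinarith
      · apply Real.sin_pos_of_pos_of_lt_pi <;> linarith
  have := hm ⟨le_rfl, ht.le⟩ ⟨ht.le, le_rfl⟩ ht
  rwa [E_zero] at this

lemma Q0_pos {κ θ : ℝ} (h0 : 1/2 < κ) (h1 : κ < 1) (hθ0 : 0 < θ) (hθ : θ < Real.pi) :
    0 < Q0 κ θ := by
  have key : 0 < E κ θ θ := by
    by_cases hc : θ ≤ Real.pi/2
    · exact E_pos h0 h1 hθ0 hc le_rfl hθ
    push Not at hc
    have p1 : 0 < E κ θ (Real.pi - θ) :=
      E_pos h0 h1 (by linarith) (by linarith) (by linarith) hθ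
    have hD : ∀ x, HasDerivAt (fun s => E κ θ s - E κ θ (Real.pi - s))
        (128*κ*(4*κ^2-1)*(1-κ^2) * ((W κ θ x - W κ θ (Real.pi - x)) * Real.sin (2*x))) x := by
      intro x
      have h := (hE κ θ x).sub (HasDerivAt.comp x (hE κ θ (Real.pi - x))
        ((hasDerivAt_id x).const_sub Real.pi))
      refine HasDerivAt.congr_deriv h ?_
      have : Real.sin (2*(Real.pi - x)) = - Real.sin (2*x) := by
        rw [show 2*(Real.pi-x) = 2*Real.pi - 2*x by ring, Real.sin_two_pi_sub]
      rw [this]; ring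
    have hm : MonotoneOn (fun s => E κ θ s - E κ θ (Real.pi - s))
        (Set.Icc (Real.pi - θ) (Real.pi/2)) := by
      apply monotoneOn_of_deriv_nonneg (convex_Icc _ _)
      · exact fun x _ => (hD x).continuousAt.continuousWithinAt
      · exact fun x _ => (hD x).differentiableAt.differentiableWithinAt
      · intro x hx
        rw [interior_Icc] at hx
        obtain ⟨hx0, hx1⟩ := hx
        rw [(hD x).deriv]
        apply mul_nonneg (K_pos h0 h1).le
        apply mul_nonneg
        · have := W_le (by linarith : 0 < κ) h1 hθ hx0.le hx1.le
          linarith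
        · apply Real.sin_nonneg_of_nonneg_of_le_pi <;> linarith
    have := hm (a := Real.pi - θ) (b := Real.pi/2) ⟨le_rfl, by linarith⟩ ⟨by linarith, le_rfl⟩ (by linarith)
    simp only [show Real.pi - Real.pi/2 = Real.pi/2 by ring, sub_sub_cancel] at this
    linarith
  rw [E_self] at key
  have : 0 < 24*κ^3 := by have : 0 < κ := by linarith
                          positivity
  exact (pos_iff_pos_of_mul_pos key).mp this

lemma Q0_eq (κ θ : ℝ) : Q0 κ θ = 4 * (Real.cos (κ*θ) * (2*κ^2*Real.sin θ^2 - Real.sin (κ*θ)^2)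
    - κ * Real.sin θ * Real.cos θ * Real.sin (κ*θ)) := by
  unfold Q0
  rw [show 3*κ*θ = 3*(κ*θ) by ring, show (2-κ)*θ = 2*θ - κ*θ by ring,
    show (2+κ)*θ = 2*θ+κ*θ by ring, Real.cos_sub, Real.cos_add, Real.cos_three_mul,
    Real.cos_two_mul, Real.sin_two_mul]
  have e1 := Real.sin_sq_add_cos_sq θ
  have e2 := Real.sin_sq_add_cos_sq (κ*θ)
  linear_combination (-8*κ^2*Real.cos (κ*θ)) * e1 + 4*Real.cos (κ*θ)*e2

noncomputable def h (κ θ : ℝ) : ℝ :=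
  (Real.cos θ * Real.sin (κ*θ) * Real.cos (κ*θ) - κ * Real.sin θ) /
    (Real.sin θ * Real.sin (κ*θ)^2)

lemma sins {κ θ : ℝ} (h0 : 1/2 < κ) (h1 : κ < 1) (hθ : θ ∈ Set.Ioo 0 Real.pi) :
    0 < Real.sin θ ∧ 0 < Real.sin (κ*θ) := by
  obtain ⟨a, b⟩ := hθ
  refine ⟨Real.sin_pos_of_pos_of_lt_pi a b, Real.sin_pos_of_pos_of_lt_pi ?_ ?_⟩
  · apply mul_pos <;> linarith
  · nlinarith

lemma hasDerivAt_h {κ θ : ℝ} (h0 : 1/2 < κ) (h1 : κ < 1) (hθ : θ ∈ Set.Ioo 0 Real.pi) :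
    HasDerivAt (h κ) (Q0 κ θ / (4 * Real.sin θ^2 * Real.sin (κ*θ)^3)) θ := by
  obtain ⟨p1, p2⟩ := sins h0 h1 hθ
  have d := ((((Real.hasDerivAt_cos θ).mul (hasDerivAt_sin_lin κ θ)).mul
    (hasDerivAt_cos_lin κ θ)).sub ((Real.hasDerivAt_sin θ).const_mul κ)).div
    ((Real.hasDerivAt_sin θ).mul ((hasDerivAt_sin_lin κ θ).pow 2)) (by
      simp only [Pi.mul_apply, Pi.pow_apply]; positivity)
  refine HasDerivAt.congr_deriv d ?_
  simp only [Pi.mul_apply, Pi.pow_apply, Pi.sub_apply]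
  rw [Q0_eq, div_eq_div_iff (by positivity) (by positivity)]
  have e1 := Real.sin_sq_add_cos_sq θ
  have e2 := Real.sin_sq_add_cos_sq (κ*θ)
  have e1' : Real.cos θ^2 = 1 - Real.sin θ^2 := by linarith
  have e2' : Real.cos (κ*θ)^2 = 1 - Real.sin (κ*θ)^2 := by linarith
  have e3' : Real.cos (κ*θ)^3 = Real.cos (κ*θ) * (1 - Real.sin (κ*θ)^2) := by
    rw [← e2']; ring
  ring_nf
  simp only [e1', e2', e3']
  ring

lemma h_mono {κ : ℝ} (h0 : 1/2 < κ) (h1 : κ < 1) : StrictMonoOn (h κ) (Set.Ioo 0 Real.pi) := by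
  apply strictMonoOn_of_deriv_pos (convex_Ioo _ _)
  · exact fun x hx => (hasDerivAt_h h0 h1 hx).continuousAt.continuousWithinAt
  · intro x hx
    rw [interior_Ioo] at hx
    obtain ⟨p1, p2⟩ := sins h0 h1 hx
    rw [(hasDerivAt_h h0 h1 hx).deriv]
    have := Q0_pos h0 h1 hx.1 hx.2
    positivity

lemma deriv_b {κ a θ : ℝ} (h0 : 1/2 < κ) (h1 : κ < 1) (hθ : θ ∈ Set.Ioo 0 Real.pi) :
    deriv (fun θ => (1 - 2 * a) * Real.cos θ + Real.sin θ * Real.cot (κ * θ)) θ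
      = Real.sin θ * (2*a - 1 + h κ θ) := by
  obtain ⟨p1, p2⟩ := sins h0 h1 hθ
  simp only [Real.cot_eq_cos_div_sin]
  have d := ((Real.hasDerivAt_cos θ).const_mul (1-2*a)).add ((Real.hasDerivAt_sin θ).mul
    ((hasDerivAt_cos_lin κ θ).div (hasDerivAt_sin_lin κ θ) p2.ne'))
  refine d.deriv.trans ?_
  simp only [Pi.div_apply]
  unfold h
  have e2 := Real.sin_sq_add_cos_sq (κ*θ)
  have e2' : Real.cos (κ*θ)^2 = 1 - Real.sin (κ*θ)^2 := by linarith
  field_simp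
  ring_nf
  simp only [e2']
  ring

lemma lim_sin : Tendsto (fun x : ℝ => (Real.sin x - x)/x^3) (𝓝[>] 0) (𝓝 (-1/6)) := by
  have hb : ∀ᶠ x : ℝ in 𝓝[>] 0, ‖(Real.sin x - x)/x^3 - (-1/6)‖ ≤ x := by
    filter_upwards [Ioo_mem_nhdsGT (show (0:ℝ) < 1 by norm_num)] with x hx
    have hx0 := hx.1
    have := Real.sin_bound (x := x) (by rw [abs_of_pos hx0]; exact hx.2.le)
    rw [show (Real.sin x - x)/x^3 - (-1/6) = (Real.sin x - (x - x^3/6))/x^3 by field_simp; ring,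
      Real.norm_eq_abs, abs_div, abs_of_pos (pow_pos hx0 3), div_le_iff₀ (by positivity)]
    rw [abs_of_pos hx0] at this
    have h4 : 0 < x^4 := by positivity
    have : x^5 ≤ x^4 := by nlinarith [hx.2]
    nlinarith
  have := squeeze_zero_norm' hb (tendsto_id.mono_left nhdsWithin_le_nhds)
  simpa using this.add_const (-1/6 : ℝ)

lemma lim_cos : Tendsto (fun x : ℝ => (Real.cos x - 1)/x^2) (𝓝[>] 0) (𝓝 (-1/2)) := by
  have hb : ∀ᶠ x : ℝ in 𝓝[>] 0, ‖(Real.cos x - 1)/x^2 - (-1/2)‖ ≤ x := by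
    filter_upwards [Ioo_mem_nhdsGT (show (0:ℝ) < 1 by norm_num)] with x hx
    have hx0 := hx.1
    have := Real.cos_bound (x := x) (by rw [abs_of_pos hx0]; exact hx.2.le)
    rw [show (Real.cos x - 1)/x^2 - (-1/2) = (Real.cos x - (1 - x^2/2))/x^2 by field_simp; ring,
      Real.norm_eq_abs, abs_div, abs_of_pos (pow_pos hx0 2), div_le_iff₀ (by positivity)]
    rw [abs_of_pos hx0] at this
    have h3 : 0 < x^3 := by positivity
    have : x^4 ≤ x^3 := by nlinarith [hx.2]
    nlinarith
  have := squeeze_zero_norm' hb (tendsto_id.mono_left nhdsWithin_le_nhds)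
  simpa using this.add_const (-1/2 : ℝ)

lemma lim_sinc : Tendsto (fun x : ℝ => Real.sin x / x) (𝓝[>] 0) (𝓝 1) := by
  have hx : Tendsto (fun x : ℝ => x^2) (𝓝[>] 0) (𝓝 0) := by
    have : Tendsto (fun x : ℝ => x^2) (𝓝 0) (𝓝 (0^2)) := (continuous_pow 2).tendsto 0
    simpa using this.mono_left nhdsWithin_le_nhds
  have := (lim_sin.mul hx).add_const 1
  simp only [mul_zero, zero_add] at this
  refine this.congr' ?_
  filter_upwards [self_mem_nhdsWithin] with x hx
  have : x ≠ 0 := ne_of_gt hx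
  field_simp
  ring

lemma lim_scale {c : ℝ} (hc : 0 < c) : Tendsto (fun x : ℝ => c*x) (𝓝[>] 0) (𝓝[>] 0) := by
  apply tendsto_nhdsWithin_of_tendsto_nhds_of_eventually_within
  · have : Tendsto (fun x : ℝ => c*x) (𝓝 0) (𝓝 (c*0)) := (continuous_const_mul c).tendsto 0
    simpa using this.mono_left nhdsWithin_le_nhds
  · filter_upwards [self_mem_nhdsWithin] with x hx
    exact mul_pos hc hx

lemma lim_h {κ : ℝ} (h0 : 1/2 < κ) (h1 : κ < 1) :
    Tendsto (h κ) (𝓝[>] 0) (𝓝 (1 - 2 * ((2*κ^2+3*κ+1)/(6*κ)))) := by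
  have hk : 0 < κ := by linarith
  have hc : Tendsto Real.cos (𝓝[>] 0) (𝓝 1) := by
    have := Real.continuous_cos.tendsto 0
    rw [Real.cos_zero] at this
    exact this.mono_left nhdsWithin_le_nhds
  have n := (((hc.mul (lim_sin.comp (lim_scale (by positivity : 0 < 2*κ)))).mul_const (4*κ^3)).add
    (lim_cos.const_mul κ)).sub (lim_sin.const_mul κ)
  have d := lim_sinc.mul (((lim_sinc.comp (lim_scale hk)).pow 2).mul_const (κ^2))
  have := n.div d (by positivity)
  refine Tendsto.congr' ?_ (this.trans_eq ?_)
  · filter_upwards [Ioo_mem_nhdsGT Real.pi_pos] with x hx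
    obtain ⟨p1, p2⟩ := sins h0 h1 hx
    have hx0 : 0 < x := hx.1
    simp only [Function.comp, Pi.div_apply, h]
    rw [show 2*κ*x = 2*(κ*x) by ring, Real.sin_two_mul]
    field_simp
    ring
  · congr 1
    field_simp
    ring

lemma exists_pos {κ a : ℝ} (h0 : 1/2 < κ) (h1 : κ < 1) :
    ∃ θ ∈ Set.Ioo 0 Real.pi, 0 < 2*a - 1 + h κ θ := by
  have hpi := Real.pi_pos
  have s : 0 < Real.sin (κ*Real.pi) := Real.sin_pos_of_pos_of_lt_pi
    (mul_pos (by linarith) hpi) (by nlinarith)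
  have c : Real.cos (κ*Real.pi) < 0 := Real.cos_neg_of_pi_div_two_lt_of_lt (by nlinarith) (by nlinarith)
  have ct : ContinuousAt (fun θ => (2*a-1) * (Real.sin θ * Real.sin (κ*θ)^2) +
      (Real.cos θ * Real.sin (κ*θ) * Real.cos (κ*θ) - κ * Real.sin θ)) Real.pi := by fun_prop
  have ev := ct.eventually (lt_mem_nhds (a := 0) (by simp; nlinarith))
  have ev2 := (ev.filter_mono (nhdsWithin_le_nhds (s := Set.Iio Real.pi))).and
    (Ioo_mem_nhdsLT hpi)
  obtain ⟨θ, q, hθ⟩ := ev2.exists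
  refine ⟨θ, hθ, ?_⟩
  obtain ⟨p1, p2⟩ := sins h0 h1 hθ
  have : 2*a - 1 + h κ θ = ((2*a-1) * (Real.sin θ * Real.sin (κ*θ)^2) +
      (Real.cos θ * Real.sin (κ*θ) * Real.cos (κ*θ) - κ * Real.sin θ)) /
      (Real.sin θ * Real.sin (κ*θ)^2) := by
    unfold h
    field_simp
  rw [this]
  positivity

end MidKappa

open MidKappa in
/-- Sign behaviour of `b'(θ)` on `I₀ = (0, π)` for `1/2 < κ < 1`,
where `b(θ) = (1 - 2a) cos θ + sin θ · cot (κθ)` and `G(κ) = (2κ² + 3κ + 1)/(6κ)`. -/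
theorem deriv_b_sign_of_middle_kappa (κ a : ℝ) (hκ0 : 1 / 2 < κ) (hκ1 : κ < 1) :
    let b : ℝ → ℝ := fun θ => (1 - 2 * a) * Real.cos θ + Real.sin θ * Real.cot (κ * θ)
    let G : ℝ → ℝ := fun x => (2 * x ^ 2 + 3 * x + 1) / (6 * x)
    (a < G κ →
      ∃ φ ∈ Set.Ioo (0 : ℝ) Real.pi, deriv b φ = 0 ∧
        (∀ θ ∈ Set.Ioo (0 : ℝ) φ, deriv b θ < 0) ∧
        (∀ θ ∈ Set.Ioo φ Real.pi, deriv b θ > 0) ∧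
        (∀ ψ ∈ Set.Ioo (0 : ℝ) Real.pi, deriv b ψ = 0 → ψ = φ)) ∧
    (a ≥ G κ → ∀ θ ∈ Set.Ioo (0 : ℝ) Real.pi, deriv b θ > 0) := by
  intro b G
  have hd : ∀ θ ∈ Set.Ioo (0:ℝ) Real.pi, deriv b θ = Real.sin θ * (2*a - 1 + h κ θ) :=
    fun θ hθ => deriv_b hκ0 hκ1 hθ
  have hm := h_mono hκ0 hκ1
  have hl : Tendsto (h κ) (𝓝[>] 0) (𝓝 (1 - 2 * G κ)) := lim_h hκ0 hκ1
  constructor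
  · intro ha
    obtain ⟨v, hv, hv2⟩ := exists_pos (a := a) hκ0 hκ1
    have ev := (hl.eventually (gt_mem_nhds (show 1 - 2 * G κ < 1 - 2*a by linarith))).and
      (Ioo_mem_nhdsGT Real.pi_pos)
    obtain ⟨u, hu2, hu⟩ := ev.exists
    have hcont : ContinuousOn (h κ) (Set.Ioo 0 Real.pi) :=
      fun x hx => (hasDerivAt_h hκ0 hκ1 hx).continuousAt.continuousWithinAt
    obtain ⟨φ, hφ, hφ2⟩ := isPreconnected_Ioo.intermediate_value hu hv hcont
      (show 1 - 2*a ∈ Set.Icc _ _ from ⟨hu2.le, by linarith⟩)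
    refine ⟨φ, hφ, ?_, ?_, ?_, ?_⟩
    · rw [hd φ hφ, hφ2]; ring
    · intro θ hθ
      have hθ' : θ ∈ Set.Ioo 0 Real.pi := ⟨hθ.1, hθ.2.trans hφ.2⟩
      rw [hd θ hθ']
      have := hm hθ' hφ hθ.2
      exact mul_neg_of_pos_of_neg (sins hκ0 hκ1 hθ').1 (by linarith)
    · intro θ hθ
      have hθ' : θ ∈ Set.Ioo 0 Real.pi := ⟨hφ.1.trans hθ.1, hθ.2⟩
      rw [hd θ hθ']
      have := hm hφ hθ' hθ.1
      exact mul_pos (sins hκ0 hκ1 hθ').1 (by linarith)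
    · intro ψ hψ h0
      rw [hd ψ hψ] at h0
      have := (mul_eq_zero.mp h0).resolve_left (sins hκ0 hκ1 hψ).1.ne'
      exact hm.injOn hψ hφ (by linarith)
  · intro ha θ hθ
    rw [hd θ hθ]
    refine mul_pos (sins hκ0 hκ1 hθ).1 ?_
    have hθ2 : θ/2 ∈ Set.Ioo 0 Real.pi := ⟨by linarith [hθ.1], by linarith [hθ.1, hθ.2]⟩
    have h1 := hm hθ2 hθ (by linarith [hθ.1])
    have h2 : 1 - 2 * G κ ≤ h κ (θ/2) := by
      apply le_of_tendsto hl
      filter_upwards [Ioo_mem_nhdsGT hθ2.1] with x hx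
      exact (hm ⟨hx.1, hx.2.trans hθ2.2⟩ hθ2 hx.2).le
    linarith
end

section
/- Let κ > 0 with κ ≠ 1 and let γ < 0; set a = γκ. Then there exists a unique θ* ∈ (0, π/(κ+1)) such that D(θ*) = 0; moreover, for every θ ∈ (0, θ*) one has D(θ) > 0 and b(θ) > 0, and the two roots in r of the quadratic equation a·r² + b(θ)·r + (a − 1) = 0 are real and strictly positive. -/
lemma aux_sin_mul_lt (m x : ℝ) (hm : 1 < m) (hx : 0 < x) (hxp : x < Real.pi)
    (h2 : m * x ≤ 2 * Real.pi) : Real.sin (m * x) < m * Real.sin x := by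
  have hs : 0 < Real.sin x := Real.sin_pos_of_pos_of_lt_pi hx hxp
  by_cases h : m * x < Real.pi
  · have hm0 : 0 < m := by linarith
    have hmx : 0 < m * x := by positivity
    have hinv : 1 / m < 1 := by rw [div_lt_one hm0]; exact hm
    have key := strictConcaveOn_sin_Icc.2
      (show (0 : ℝ) ∈ Set.Icc 0 Real.pi from ⟨le_refl _, Real.pi_pos.le⟩)
      (show m * x ∈ Set.Icc 0 Real.pi from ⟨hmx.le, h.le⟩) hmx.ne
      (show 0 < 1 - 1 / m by linarith) (show 0 < 1 / m by positivity) (by ring)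
    simp only [smul_eq_mul, Real.sin_zero, mul_zero, zero_add] at key
    have e : 1 / m * (m * x) = x := by field_simp
    rw [e] at key
    have := mul_lt_mul_of_pos_left key hm0
    have e2 : m * (1 / m * Real.sin (m * x)) = Real.sin (m * x) := by field_simp
    linarith
  · have h3 : 0 ≤ Real.sin (m * x - Real.pi) :=
      Real.sin_nonneg_of_nonneg_of_le_pi (by linarith) (by linarith)
    rw [Real.sin_sub_pi] at h3
    have : 0 < m * Real.sin x := by apply mul_pos <;> linarith
    linarith

lemma aux_range (κ θ : ℝ) (hκ : 0 < κ) (hθ : θ ∈ Set.Ioc (0 : ℝ) (Real.pi / (κ + 1))) :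
    0 < θ ∧ 0 < κ * θ ∧ (κ + 1) * θ ≤ Real.pi := by
  obtain ⟨h0, h1⟩ := hθ
  rw [le_div_iff₀ (by linarith)] at h1
  exact ⟨h0, by positivity, by linarith⟩

lemma aux_strictAnti (κ a : ℝ) (hκ : 0 < κ) (ha : a < 0) :
    ContinuousOn (fun θ => -2 * a * Real.cos θ + Real.sin ((κ + 1) * θ) / Real.sin (κ * θ))
      (Set.Ioc (0 : ℝ) (Real.pi / (κ + 1))) ∧
    StrictAntiOn (fun θ => -2 * a * Real.cos θ + Real.sin ((κ + 1) * θ) / Real.sin (κ * θ))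
      (Set.Ioc (0 : ℝ) (Real.pi / (κ + 1))) := by
  have hsin : ∀ θ ∈ Set.Ioc (0 : ℝ) (Real.pi / (κ + 1)), 0 < Real.sin (κ * θ) := by
    intro θ hθ
    obtain ⟨h0, h1, h2⟩ := aux_range κ θ hκ hθ
    exact Real.sin_pos_of_pos_of_lt_pi h1 (by linarith)
  have hc : ContinuousOn
      (fun θ => -2 * a * Real.cos θ + Real.sin ((κ + 1) * θ) / Real.sin (κ * θ))
      (Set.Ioc (0 : ℝ) (Real.pi / (κ + 1))) := by
    apply ContinuousOn.add (by fun_prop)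
    exact ContinuousOn.div (by fun_prop) (by fun_prop) (fun θ hθ => (hsin θ hθ).ne')
  refine ⟨hc, strictAntiOn_of_deriv_neg (convex_Ioc _ _) hc ?_⟩
  intro θ hθ
  rw [interior_Ioc] at hθ
  have hθ' := Set.Ioo_subset_Ioc_self hθ
  obtain ⟨h0, h1, h2⟩ := aux_range κ θ hκ hθ'
  have hs := hsin θ hθ'
  have d1 : HasDerivAt (fun θ : ℝ => Real.sin ((κ + 1) * θ))
      (Real.cos ((κ + 1) * θ) * ((κ + 1) * 1)) θ :=
    ((hasDerivAt_id' θ).const_mul (κ + 1)).sin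
  have d2 : HasDerivAt (fun θ : ℝ => Real.sin (κ * θ)) (Real.cos (κ * θ) * (κ * 1)) θ :=
    ((hasDerivAt_id' θ).const_mul κ).sin
  have d3 := ((Real.hasDerivAt_cos θ).const_mul (-2 * a)).fun_add (d1.fun_div d2 hs.ne')
  rw [d3.deriv]
  have hsθ : 0 < Real.sin θ := Real.sin_pos_of_pos_of_lt_pi h0 (by linarith)
  have hl := aux_sin_mul_lt (2 * κ + 1) θ (by linarith) h0 (by linarith) (by linarith)
  have e1 : Real.sin θ = Real.sin ((κ + 1) * θ) * Real.cos (κ * θ)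
      - Real.cos ((κ + 1) * θ) * Real.sin (κ * θ) := by
    rw [← Real.sin_sub]; congr 1; ring
  have e2 : Real.sin ((2 * κ + 1) * θ) = Real.sin ((κ + 1) * θ) * Real.cos (κ * θ)
      + Real.cos ((κ + 1) * θ) * Real.sin (κ * θ) := by
    rw [← Real.sin_add]; congr 1; ring
  have hn : (Real.cos ((κ + 1) * θ) * ((κ + 1) * 1) * Real.sin (κ * θ)
      - Real.sin ((κ + 1) * θ) * (Real.cos (κ * θ) * (κ * 1))) / Real.sin (κ * θ) ^ 2 < 0 := by
    apply div_neg_of_neg_of_pos _ (by positivity)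
    rw [e2, e1] at hl
    linarith
  have : a * Real.sin θ < 0 := mul_neg_of_neg_of_pos ha hsθ
  linarith

/-- For `κ > 0`, `κ ≠ 1` and `γ < 0` with `a = γκ`, there is a unique `θ* ∈ (0, π/(κ+1))`
with `D(θ*) = 0`; on `(0, θ*)` one has `D(θ) > 0`, `b(θ) > 0`, and both roots
`(-b(θ) ± √D(θ))/(2a)` of `a r² + b(θ) r + (a - 1) = 0` are real and strictly positive. -/
theorem discriminant_zero_unique_of_gamma_neg (κ γ : ℝ) (hκ : 0 < κ) (hκ1 : κ ≠ 1)
    (hγ : γ < 0) :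
    let a : ℝ := γ * κ
    let b : ℝ → ℝ := fun θ => (1 - 2 * a) * Real.cos θ + Real.sin θ * Real.cot (κ * θ)
    let D : ℝ → ℝ := fun θ => (b θ) ^ 2 - 4 * a * (a - 1)
    ∃ θs ∈ Set.Ioo (0 : ℝ) (Real.pi / (κ + 1)),
      D θs = 0 ∧
      (∀ θ ∈ Set.Ioo (0 : ℝ) (Real.pi / (κ + 1)), D θ = 0 → θ = θs) ∧
      ∀ θ ∈ Set.Ioo (0 : ℝ) θs,
        D θ > 0 ∧ b θ > 0 ∧
        0 < (-(b θ) + Real.sqrt (D θ)) / (2 * a) ∧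
        0 < (-(b θ) - Real.sqrt (D θ)) / (2 * a) ∧
        a * ((-(b θ) + Real.sqrt (D θ)) / (2 * a)) ^ 2
          + b θ * ((-(b θ) + Real.sqrt (D θ)) / (2 * a)) + (a - 1) = 0 ∧
        a * ((-(b θ) - Real.sqrt (D θ)) / (2 * a)) ^ 2
          + b θ * ((-(b θ) - Real.sqrt (D θ)) / (2 * a)) + (a - 1) = 0 := by
  intro a b D
  have ha : a < 0 := mul_neg_of_neg_of_pos hγ hκ
  set M : ℝ := Real.sqrt (4 * a * (a - 1)) with hM
  have haa : 0 < 4 * a * (a - 1) := by nlinarith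
  have hM0 : 0 < M := Real.sqrt_pos.2 haa
  have hM2 : M ^ 2 = 4 * a * (a - 1) := Real.sq_sqrt haa.le
  have hM1 : M < 1 - 2 * a := by
    apply lt_of_pow_lt_pow_left₀ 2 (by linarith)
    rw [hM2]; nlinarith
  have hM3 : -2 * a < M := by
    apply lt_of_pow_lt_pow_left₀ 2 hM0.le
    rw [hM2]; nlinarith
  have hE0 : 0 < Real.pi / (κ + 1) := by have := Real.pi_pos; positivity
  have hbeq : ∀ θ ∈ Set.Ioc (0 : ℝ) (Real.pi / (κ + 1)),
      b θ = -2 * a * Real.cos θ + Real.sin ((κ + 1) * θ) / Real.sin (κ * θ) := by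
    intro θ hθ
    obtain ⟨h0, h1, h2⟩ := aux_range κ θ hκ hθ
    have hs : 0 < Real.sin (κ * θ) := Real.sin_pos_of_pos_of_lt_pi h1 (by linarith)
    have e : Real.sin ((κ + 1) * θ) = Real.sin (κ * θ) * Real.cos θ
        + Real.cos (κ * θ) * Real.sin θ := by
      rw [← Real.sin_add]; congr 1; ring
    simp only [b]
    rw [e, Real.cot_eq_cos_div_sin]
    field_simp
    ring
  obtain ⟨hc, hanti⟩ := aux_strictAnti κ a hκ ha
  have hbc : ContinuousOn b (Set.Ioc (0 : ℝ) (Real.pi / (κ + 1))) := hc.congr hbeq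
  have hba : StrictAntiOn b (Set.Ioc (0 : ℝ) (Real.pi / (κ + 1))) := by
    intro x hx y hy hxy
    rw [hbeq x hx, hbeq y hy]
    exact hanti hx hy hxy
  have hcos : ∀ x : ℝ, -2 * a * Real.cos x ≤ -2 * a ∧ -(-2 * a) ≤ -2 * a * Real.cos x := by
    intro x
    constructor <;> nlinarith [Real.cos_le_one x, Real.neg_one_le_cos x]
  have hend : b (Real.pi / (κ + 1)) < M := by
    rw [hbeq _ ⟨hE0, le_refl _⟩]
    have : (κ + 1) * (Real.pi / (κ + 1)) = Real.pi := by field_simp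
    rw [this, Real.sin_pi, zero_div]
    linarith [(hcos (Real.pi / (κ + 1))).1]
  have hlow : ∀ θ ∈ Set.Ioc (0 : ℝ) (Real.pi / (κ + 1)), -M < b θ := by
    intro θ hθ
    obtain ⟨h0, h1, h2⟩ := aux_range κ θ hκ hθ
    have hs : 0 < Real.sin (κ * θ) := Real.sin_pos_of_pos_of_lt_pi h1 (by linarith)
    have hs2 : 0 ≤ Real.sin ((κ + 1) * θ) :=
      Real.sin_nonneg_of_nonneg_of_le_pi (by positivity) h2
    rw [hbeq θ hθ]
    have := div_nonneg hs2 hs.le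
    linarith [(hcos θ).2]
  have hstart : ∃ t ∈ Set.Ioo (0 : ℝ) (Real.pi / (κ + 1)), M < b t := by
    have hev : ∀ᶠ t in nhdsWithin (0 : ℝ) (Set.Ioi 0), M < (1 - 2 * a) * Real.cos t := by
      have hcont : Continuous (fun t : ℝ => (1 - 2 * a) * Real.cos t) := by fun_prop
      have h := hcont.continuousAt (x := 0)
      exact (h.eventually (lt_mem_nhds (by simpa using hM1))).filter_mono nhdsWithin_le_nhds
    have hev2 : ∀ᶠ t in nhdsWithin (0 : ℝ) (Set.Ioi 0), t ∈ Set.Ioo (0 : ℝ) (Real.pi / (κ + 1)) :=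
      Ioo_mem_nhdsGT hE0
    have hev3 : ∀ᶠ t in nhdsWithin (0 : ℝ) (Set.Ioi 0),
        t ∈ Set.Ioo (0 : ℝ) (Real.pi / 2 / κ) :=
      Ioo_mem_nhdsGT (by have := Real.pi_pos; positivity)
    obtain ⟨t, h1, h2, h3⟩ := (hev.and (hev2.and hev3)).exists
    refine ⟨t, h2, ?_⟩
    obtain ⟨g0, g1, g2⟩ := aux_range κ t hκ (Set.Ioo_subset_Ioc_self h2)
    have h4 : t * κ < Real.pi / 2 := (lt_div_iff₀ hκ).1 h3.2
    have hcot : 0 ≤ Real.cot (κ * t) := by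
      rw [Real.cot_eq_cos_div_sin]
      apply div_nonneg
      · exact Real.cos_nonneg_of_neg_pi_div_two_le_of_le (by linarith [Real.pi_pos]) (by linarith)
      · exact Real.sin_nonneg_of_nonneg_of_le_pi g1.le (by linarith)
    have hst : 0 ≤ Real.sin t := Real.sin_nonneg_of_nonneg_of_le_pi g0.le (by linarith)
    have := mul_nonneg hst hcot
    simp only [b]
    linarith
  obtain ⟨t, ht, htM⟩ := hstart
  have hsub : Set.Icc t (Real.pi / (κ + 1)) ⊆ Set.Ioc (0 : ℝ) (Real.pi / (κ + 1)) :=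
    fun x hx => ⟨lt_of_lt_of_le ht.1 hx.1, hx.2⟩
  obtain ⟨θs, hθs, hbs⟩ := intermediate_value_Ioo' ht.2.le (hbc.mono hsub)
    (show M ∈ Set.Ioo (b (Real.pi / (κ + 1))) (b t) from ⟨hend, htM⟩)
  have hθsm : θs ∈ Set.Ioo (0 : ℝ) (Real.pi / (κ + 1)) := ⟨lt_trans ht.1 hθs.1, hθs.2⟩
  refine ⟨θs, hθsm, ?_, ?_, ?_⟩
  · simp only [D]
    rw [hbs, hM2, sub_self]
  · intro θ hθ hD
    have hθ' := Set.Ioo_subset_Ioc_self hθ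
    apply hba.injOn hθ' (Set.Ioo_subset_Ioc_self hθsm)
    rw [hbs]
    have h1 : (b θ - M) * (b θ + M) = 0 := by
      have : b θ ^ 2 - 4 * a * (a - 1) = 0 := hD
      rw [← hM2] at this
      linarith
    rcases mul_eq_zero.1 h1 with h | h
    · linarith
    · linarith [hlow θ hθ']
  · intro θ hθ
    have hbM : M < b θ := by
      rw [← hbs]
      exact hba ⟨hθ.1, (hθ.2.trans hθsm.2).le⟩ (Set.Ioo_subset_Ioc_self hθsm) hθ.2
    have hb0 : 0 < b θ := hM0.trans hbM
    have hDe : D θ = b θ ^ 2 - 4 * a * (a - 1) := rfl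
    have hD0 : 0 < D θ := by rw [hDe, ← hM2]; nlinarith
    have hsq : Real.sqrt (D θ) ^ 2 = b θ ^ 2 - 4 * a * (a - 1) := by
      rw [Real.sq_sqrt hD0.le]
    have hs0 : 0 ≤ Real.sqrt (D θ) := Real.sqrt_nonneg _
    have hsb : Real.sqrt (D θ) < b θ := by
      apply lt_of_pow_lt_pow_left₀ 2 hb0.le
      rw [hsq]; linarith
    generalize Real.sqrt (D θ) = s at *
    generalize b θ = B at *
    have ha0 : a ≠ 0 := ha.ne
    clear_value a
    refine ⟨hD0, hb0, div_pos_of_neg_of_neg (by linarith) (by linarith),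
      div_pos_of_neg_of_neg (by linarith) (by linarith), ?_, ?_⟩
    · field_simp
      linear_combination hsq
    · field_simp
      linear_combination hsq
end

section
/- Let 0 < κ < 1 and γ ∈ ℝ with a = γκ > 1, and let θ ∈ (0, π). If b(θ)² ≥ 4a(a − 1), then b(θ) > 0. In particular, whenever the quadratic equation a·r² + b(θ)·r + (a − 1) = 0 has real roots in r, both roots are negative. -/
/-- For `0 < κ < 1`, `a = γκ > 1` and `θ ∈ (0, π)`: if `b(θ)² ≥ 4a(a-1)` then `b(θ) > 0`;
in particular every real root of `a r² + b(θ) r + (a - 1) = 0` is negative. -/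
theorem b_pos_and_roots_neg (κ γ : ℝ) (hκ0 : 0 < κ) (hκ1 : κ < 1)
    (ha : 1 < γ * κ) (θ : ℝ) (hθ : θ ∈ Set.Ioo (0 : ℝ) Real.pi)
    (hD : ((1 - 2 * (γ * κ)) * Real.cos θ + Real.sin θ * Real.cot (κ * θ)) ^ 2 ≥
      4 * (γ * κ) * (γ * κ - 1)) :
    (1 - 2 * (γ * κ)) * Real.cos θ + Real.sin θ * Real.cot (κ * θ) > 0 ∧
    ∀ r : ℝ,
      (γ * κ) * r ^ 2 +
        ((1 - 2 * (γ * κ)) * Real.cos θ + Real.sin θ * Real.cot (κ * θ)) * r +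
        (γ * κ - 1) = 0 → r < 0 := by
  obtain ⟨h0, hpi⟩ := hθ
  have hx0 : 0 < κ * θ := mul_pos hκ0 h0
  have hx1 : κ * θ < θ := by nlinarith
  have hs : 0 < Real.sin (κ * θ) := Real.sin_pos_of_pos_of_lt_pi hx0 (hx1.trans hpi)
  have hd : 0 < Real.sin (θ - κ * θ) :=
    Real.sin_pos_of_pos_of_lt_pi (by linarith) (by linarith)
  rw [Real.sin_sub] at hd
  have hc : Real.cos θ < Real.sin θ * Real.cot (κ * θ) := by
    rw [Real.cot_eq_cos_div_sin, ← mul_div_assoc, lt_div_iff₀ hs]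
    linarith
  have hcos : Real.cos θ ≤ 1 := Real.cos_le_one θ
  generalize γ * κ = a at *
  have hlow : -(2 * (a - 1)) <
      (1 - 2 * a) * Real.cos θ + Real.sin θ * Real.cot (κ * θ) := by nlinarith
  generalize (1 - 2 * a) * Real.cos θ + Real.sin θ * Real.cot (κ * θ) = b at *
  have hb : 0 < b := by
    by_contra hn
    push Not at hn
    nlinarith
  refine ⟨hb, fun r hr => ?_⟩
  by_contra hn
  push Not at hn
  have h1 : 0 ≤ a * r ^ 2 := mul_nonneg (by linarith) (sq_nonneg r)
  have h2 : 0 ≤ b * r := mul_nonneg hb.le hn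
  linarith
end

section
/- Let 0 < γ ≤ 1/4. Then g'(y) < 0 for every y ∈ (0, π); consequently g is strictly decreasing on [0, π] and satisfies −1 < g(y) < 1 for all y ∈ (0, π). -/
/-- For `0 < γ ≤ 1/4`, the function `g(y) = cos y + 2γ y sin y` has negative derivative on
`(0, π)`, is strictly decreasing on `[0, π]`, and satisfies `-1 < g y < 1` on `(0, π)`. -/
theorem g_strict_anti_of_gamma_small (γ : ℝ) (hγ0 : 0 < γ) (hγ : γ ≤ 1 / 4) :
    let g : ℝ → ℝ := fun y => Real.cos y + 2 * γ * y * Real.sin y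
    (∀ y ∈ Set.Ioo (0 : ℝ) Real.pi, deriv g y < 0) ∧
    StrictAntiOn g (Set.Icc (0 : ℝ) Real.pi) ∧
    (∀ y ∈ Set.Ioo (0 : ℝ) Real.pi, -1 < g y ∧ g y < 1) := by
  intro g
  have hd : ∀ y ∈ Set.Ioo (0 : ℝ) Real.pi, deriv g y < 0 := by
    rintro y ⟨h0, hpi⟩
    have hs : 0 < Real.sin y := Real.sin_pos_of_pos_of_lt_pi h0 hpi
    have key : y * Real.cos y < Real.sin y := by
      rcases lt_or_ge y (Real.pi / 2) with h | h
      · have hc : 0 < Real.cos y := Real.cos_pos_of_mem_Ioo ⟨by linarith, h⟩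
        have ht := Real.lt_tan h0 h
        rwa [Real.tan_eq_sin_div_cos, lt_div_iff₀ hc] at ht
      · have hc : Real.cos y ≤ 0 :=
          Real.cos_nonpos_of_pi_div_two_le_of_le h (by linarith [Real.pi_pos])
        nlinarith
    have hg : HasDerivAt g
        (-Real.sin y + (2 * γ * 1 * Real.sin y + 2 * γ * y * Real.cos y)) y :=
      (Real.hasDerivAt_cos y).add
        (((hasDerivAt_id' y).const_mul (2 * γ)).mul (Real.hasDerivAt_sin y))
    rw [hg.deriv]
    nlinarith [mul_pos hγ0 (sub_pos.2 key), mul_nonneg (sub_nonneg.2 hγ) hs.le]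
  have hanti : StrictAntiOn g (Set.Icc (0 : ℝ) Real.pi) := by
    apply strictAntiOn_of_deriv_neg (convex_Icc _ _)
    · exact Continuous.continuousOn (by fun_prop)
    · rw [interior_Icc]; exact hd
  refine ⟨hd, hanti, ?_⟩
  rintro y ⟨h0, hpi⟩
  have hp := Real.pi_pos.le
  have h1 := hanti ⟨le_refl _, hp⟩ ⟨h0.le, hpi.le⟩ h0
  have h2 := hanti ⟨h0.le, hpi.le⟩ ⟨hp, le_refl _⟩ hpi
  have e0 : g 0 = 1 := by simp [g]
  have e1 : g Real.pi = -1 := by simp [g]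
  rw [e0] at h1
  rw [e1] at h2
  exact ⟨h2, h1⟩
end

section
/- Let γ > 1/4. Then there exists a unique y₀ ∈ (0, π) with g(y₀) = 1; moreover g(y) > 1 for all y ∈ (0, y₀) and g(y) < 1 for all y ∈ (y₀, π). -/
lemma aux_slope (s t : ℝ) (hs : 0 < s) (hst : s < t) (ht : t < Real.pi / 2) :
    t * Real.cos t * Real.sin s < s * Real.cos s * Real.sin t := by
  have hw : 2 * s / (t + s) + (t - s) / (t + s) = 1 := by
    have : t + s ≠ 0 := by linarith
    field_simp
    ring
  have hc := strictConcaveOn_sin_Icc.2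
    (show (0 : ℝ) ∈ Set.Icc 0 Real.pi from ⟨le_rfl, Real.pi_pos.le⟩)
    (show t + s ∈ Set.Icc 0 Real.pi from ⟨by linarith, by linarith⟩) (by linarith)
    (div_pos (by linarith) (by linarith)) (div_pos (by linarith) (by linarith)) hw
  have hne : t + s ≠ 0 := by linarith
  have hpos : 0 < t + s := by linarith
  have h1 : (t - s) / (t + s) * (t + s) = t - s := by field_simp
  simp only [smul_eq_mul, mul_zero, Real.sin_zero, zero_add, h1] at hc
  have h2 := mul_lt_mul_of_pos_left hc hpos
  have h3 : (t + s) * ((t - s) / (t + s) * Real.sin (t + s)) = (t - s) * Real.sin (t + s) := by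
    field_simp
  rw [h3, Real.sin_add, Real.sin_sub] at h2
  nlinarith

lemma aux_id (γ t : ℝ) : Real.cos (2 * t) + 2 * γ * (2 * t) * Real.sin (2 * t) - 1 =
    2 * Real.sin t * (4 * γ * (t * Real.cos t) - Real.sin t) := by
  rw [Real.cos_two_mul, Real.sin_two_mul]
  linear_combination 2 * Real.sin_sq_add_cos_sq t

lemma aux_exists (c : ℝ) (hc : 1 < c) :
    ∃ t, 0 < t ∧ t < Real.pi / 2 ∧ c * (t * Real.cos t) = Real.sin t := by
  have hp := Real.pi_gt_three
  obtain ⟨a, ha0, ha1, ha2⟩ : ∃ a : ℝ, 0 < a ∧ a < 1 ∧ c * a ^ 2 = c - 1 := by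
    have h0 : 0 < (c - 1) / c := div_pos (by linarith) (by linarith)
    have h1 : (c - 1) / c < 1 := by rw [div_lt_one (by linarith)]; linarith
    refine ⟨Real.sqrt ((c - 1) / c), Real.sqrt_pos.2 h0, ?_, ?_⟩
    · rw [Real.sqrt_lt' one_pos]; simpa using h1
    · rw [Real.sq_sqrt h0.le]; field_simp
  have hka : 0 < c * (a * Real.cos a) - Real.sin a := by
    have h1 := Real.one_sub_sq_div_two_le_cos (x := a)
    have h2 := Real.sin_lt ha0
    have h3 := mul_le_mul_of_nonneg_left h1 (mul_pos (by linarith : 0 < c) ha0).le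
    have h4 : c * a * (1 - a ^ 2 / 2) = a + a * (c - 1) / 2 := by
      linear_combination (-a / 2) * ha2
    have h5 : 0 < a * (c - 1) := mul_pos ha0 (by linarith)
    nlinarith
  have hcont : ContinuousOn (fun t => c * (t * Real.cos t) - Real.sin t)
      (Set.Icc a (Real.pi / 2)) := by fun_prop
  obtain ⟨t, ht, hk⟩ := intermediate_value_Ioo' (by linarith) hcont
    (show (0 : ℝ) ∈ Set.Ioo _ _ from ⟨by simp, hka⟩)
  exact ⟨t, ha0.trans ht.1, ht.2, by simpa [sub_eq_zero] using hk⟩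

/-- For `γ > 1/4`, there is a unique `y₀ ∈ (0, π)` with `g(y₀) = 1`, where
`g(y) = cos y + 2γ y sin y`; moreover `g > 1` on `(0, y₀)` and `g < 1` on `(y₀, π)`. -/
theorem g_crosses_one_of_gamma_large (γ : ℝ) (hγ : 1 / 4 < γ) :
    let g : ℝ → ℝ := fun y => Real.cos y + 2 * γ * y * Real.sin y
    ∃ y₀ ∈ Set.Ioo (0 : ℝ) Real.pi,
      g y₀ = 1 ∧
      (∀ y ∈ Set.Ioo (0 : ℝ) y₀, g y > 1) ∧
      (∀ y ∈ Set.Ioo y₀ Real.pi, g y < 1) ∧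
      (∀ y ∈ Set.Ioo (0 : ℝ) Real.pi, g y = 1 → y = y₀) := by
  intro g
  obtain ⟨t, ht0, ht1, hk⟩ := aux_exists (4 * γ) (by linarith)
  have hid : ∀ y, g y - 1 = 2 * Real.sin (y / 2) *
      (4 * γ * (y / 2 * Real.cos (y / 2)) - Real.sin (y / 2)) := by
    intro y
    rw [← aux_id, mul_div_cancel₀ y (two_ne_zero)]
  have hsin : ∀ s, 0 < s → s < Real.pi / 2 → 0 < Real.sin s := fun s h1 h2 =>
    Real.sin_pos_of_pos_of_lt_pi h1 (by linarith)
  have hP : 0 < t * Real.cos t :=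
    mul_pos ht0 (Real.cos_pos_of_mem_Ioo ⟨by linarith, ht1⟩)
  have hlo : ∀ y ∈ Set.Ioo (0 : ℝ) (2 * t), g y > 1 := by
    rintro y ⟨h1, h2⟩
    have h := aux_slope (y / 2) t (by linarith) (by linarith) ht1
    rw [← hk] at h
    have h' : 0 < t * Real.cos t *
      (4 * γ * (y / 2 * Real.cos (y / 2)) - Real.sin (y / 2)) := by linarith
    have := mul_pos (mul_pos two_pos (hsin (y / 2) (by linarith) (by linarith)))
      (pos_of_mul_pos_right h' hP.le)
    linarith [hid y]
  have hhi : ∀ y ∈ Set.Ioo (2 * t) Real.pi, g y < 1 := by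
    rintro y ⟨h1, h2⟩
    have h := aux_slope t (y / 2) ht0 (by linarith) (by linarith)
    rw [← hk] at h
    have h' : 0 < t * Real.cos t *
      (Real.sin (y / 2) - 4 * γ * (y / 2 * Real.cos (y / 2))) := by linarith
    have := mul_pos (mul_pos two_pos (hsin (y / 2) (by linarith) (by linarith)))
      (pos_of_mul_pos_right h' hP.le)
    linarith [hid y]
  refine ⟨2 * t, ⟨by linarith, by linarith⟩, ?_, hlo, hhi, ?_⟩
  · have := aux_id γ t
    rw [hk, sub_self, mul_zero] at this
    exact sub_eq_zero.1 this
  · rintro y ⟨h1, h2⟩ hy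
    rcases lt_trichotomy y (2 * t) with h | h | h
    · exact absurd hy (hlo y ⟨h1, h⟩).ne'
    · exact h
    · exact absurd hy (hhi y ⟨h, h2⟩).ne
end

section
/- Let γ < 0. Then there exists a unique y₀ ∈ (0, π) with g(y₀) = −1; moreover g(y) > −1 for all y ∈ (0, y₀) and g(y) < −1 for all y ∈ (y₀, π). -/
/-- For `γ < 0`, there is a unique `y₀ ∈ (0, π)` with `g(y₀) = -1`, where
`g(y) = cos y + 2γ y sin y`; moreover `g > -1` on `(0, y₀)` and `g < -1` on `(y₀, π)`. -/
theorem g_crosses_neg_one_of_gamma_neg (γ : ℝ) (hγ : γ < 0) :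
    let g : ℝ → ℝ := fun y => Real.cos y + 2 * γ * y * Real.sin y
    ∃ y₀ ∈ Set.Ioo (0 : ℝ) Real.pi,
      g y₀ = -1 ∧
      (∀ y ∈ Set.Ioo (0 : ℝ) y₀, g y > -1) ∧
      (∀ y ∈ Set.Ioo y₀ Real.pi, g y < -1) ∧
      (∀ y ∈ Set.Ioo (0 : ℝ) Real.pi, g y = -1 → y = y₀) := by
  intro g
  have hpi := Real.pi_pos
  let k : ℝ → ℝ := fun y => Real.cos (y / 2) + 2 * γ * (y * Real.sin (y / 2))
  have hgk : ∀ y, g y = -1 + 2 * Real.cos (y / 2) * k y := by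
    intro y
    have h1 : Real.cos y = 2 * Real.cos (y / 2) ^ 2 - 1 := by
      rw [← Real.cos_two_mul]; congr 1; ring
    have h2 : Real.sin y = 2 * Real.sin (y / 2) * Real.cos (y / 2) := by
      rw [← Real.sin_two_mul]; congr 1; ring
    simp only [g, k, h1, h2]
    ring
  have hcos : ∀ y, 0 < y → y < Real.pi → 0 < Real.cos (y / 2) := by
    intro y h0 h1
    exact Real.cos_pos_of_mem_Ioo ⟨by linarith, by linarith⟩
  have hanti : ∀ a b, 0 ≤ a → a < b → b ≤ Real.pi → k b < k a := by
    intro a b h0 hab hb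
    have h1 : Real.cos (b / 2) < Real.cos (a / 2) :=
      Real.cos_lt_cos_of_nonneg_of_le_pi (by linarith) (by linarith) (by linarith)
    have h2 : Real.sin (a / 2) < Real.sin (b / 2) :=
      Real.sin_lt_sin_of_lt_of_le_pi_div_two (by linarith) (by linarith) (by linarith)
    have h3 : 0 ≤ Real.sin (a / 2) :=
      Real.sin_nonneg_of_nonneg_of_le_pi (by linarith) (by linarith)
    have h4 : a * Real.sin (a / 2) ≤ b * Real.sin (b / 2) :=
      mul_le_mul hab.le h2.le h3 (by linarith)
    simp only [k]
    nlinarith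
  have hk0 : k 0 = 1 := by simp [k]
  have hkpi : k Real.pi < 0 := by
    simp only [k, Real.cos_pi_div_two, Real.sin_pi_div_two]
    nlinarith
  have hcont : ContinuousOn k (Set.Icc 0 Real.pi) := by
    apply Continuous.continuousOn
    simp only [k]
    fun_prop
  obtain ⟨y₀, ⟨h0, h1⟩, hy⟩ := intermediate_value_Ioo' hpi.le hcont
    (show (0 : ℝ) ∈ Set.Ioo (k Real.pi) (k 0) from ⟨hkpi, by rw [hk0]; norm_num⟩)
  have hlow : ∀ y ∈ Set.Ioo (0 : ℝ) y₀, g y > -1 := by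
    rintro y ⟨ha, hb⟩
    have h2 := hanti y y₀ ha.le hb h1.le
    have h3 := hcos y ha (hb.trans h1)
    rw [hy] at h2
    rw [hgk]
    have := mul_pos h3 h2
    linarith
  have hhigh : ∀ y ∈ Set.Ioo y₀ Real.pi, g y < -1 := by
    rintro y ⟨ha, hb⟩
    have h2 := hanti y₀ y h0.le ha hb.le
    have h3 := hcos y (h0.trans ha) hb
    rw [hy] at h2
    rw [hgk]
    have := mul_neg_of_pos_of_neg h3 h2
    linarith
  refine ⟨y₀, ⟨h0, h1⟩, by rw [hgk, hy]; ring, hlow, hhigh, ?_⟩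
  rintro y ⟨ha, hb⟩ he
  rcases lt_trichotomy y y₀ with h | h | h
  · exact absurd he (hlow y ⟨ha, h⟩).ne'
  · exact h
  · exact absurd he (hhigh y ⟨h, hb⟩).ne
end

section
/- Let κ > 0 and γ < 0, and let α₁ < α₂ be the two real roots of the quadratic q(z) := γz² + (1 + 1/κ)z + 1 (these roots are real since the discriminant (1 + 1/κ)² − 4γ is positive). Then −κ < α₁ < 0 < α₂, and f(α₂) < f(α₁) < 0, where f(x) := x/(1 + γx) · (1 + x/κ)^κ with the real power (1 + x/κ)^κ, which is well defined since 1 + αᵢ/κ > 0. -/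
/-- For `κ > 0` and `γ < 0`, if `α₁ < α₂` are the two real roots of
`q(z) = γ z² + (1 + 1/κ) z + 1`, then `-κ < α₁ < 0 < α₂` and
`f(α₂) < f(α₁) < 0`, where `f(x) = x/(1 + γx) · (1 + x/κ)^κ` (real power). -/
theorem tsallis_values_at_critical_points (κ γ α₁ α₂ : ℝ) (hκ : 0 < κ) (hγ : γ < 0)
    (hlt : α₁ < α₂)
    (h₁ : γ * α₁ ^ 2 + (1 + 1 / κ) * α₁ + 1 = 0)
    (h₂ : γ * α₂ ^ 2 + (1 + 1 / κ) * α₂ + 1 = 0) :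
    let f : ℝ → ℝ := fun x => x / (1 + γ * x) * (1 + x / κ) ^ κ;
    -κ < α₁ ∧ α₁ < 0 ∧ 0 < α₂ ∧ f α₂ < f α₁ ∧ f α₁ < 0 := by
  intro f
  have hk : 0 < 1 / κ := by positivity
  have hu : κ * (1 / κ) = 1 := by field_simp
  have hdiv : ∀ x : ℝ, x / κ = x * (1 / κ) := fun x => by ring
  set u := 1 / κ
  have hsum : γ * (α₁ + α₂) + (1 + u) = 0 := by
    have h : (α₁ - α₂) * (γ * (α₁ + α₂) + (1 + u)) = 0 := by linear_combination h₁ - h₂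
    rcases mul_eq_zero.mp h with h | h
    · linarith
    · exact h
  have hprod : γ * (α₁ * α₂) = 1 := by linear_combination α₁ * hsum - h₁
  have hneg : α₁ * α₂ < 0 := by
    by_contra hc
    have := mul_nonneg (neg_nonneg.mpr hγ.le) (not_lt.mp hc)
    linarith
  have ha1 : α₁ < 0 := by
    by_contra hc
    have := mul_nonneg (not_lt.mp hc) ((not_lt.mp hc).trans hlt.le)
    linarith
  have ha2 : 0 < α₂ := by
    by_contra hc
    have := mul_nonneg_of_nonpos_of_nonpos ha1.le (not_lt.mp hc)
    linarith
  have hrel : α₁ + α₂ = -(1 + u) * (α₁ * α₂) := by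
    linear_combination (α₁ * α₂) * hsum - (α₁ + α₂) * hprod
  have hA : 0 < 1 + α₁ * u := by
    have h : α₂ * (1 + α₁ * u) = -α₁ * (1 + α₂) := by linear_combination hrel
    have h' : 0 < α₂ * (1 + α₁ * u) := by
      rw [h]; exact mul_pos (by linarith) (by linarith)
    exact pos_of_mul_pos_right h' ha2.le
  have hB : 0 < 1 + α₂ * u := by positivity
  have hAB : 1 + α₁ * u < 1 + α₂ * u := by
    have := mul_lt_mul_of_pos_right hlt hk
    linarith
  have hpow := Real.rpow_lt_rpow hA.le hAB hκ
  have hpA : 0 < (1 + α₁ * u) ^ κ := Real.rpow_pos_of_pos hA κ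
  have hval : ∀ x : ℝ, x ≠ 0 → 0 < 1 + x * u → γ * x ^ 2 + (1 + u) * x + 1 = 0 →
      f x = -(x ^ 2 / (1 + x * u) * (1 + x * u) ^ κ) := by
    intro x hx hp hq
    have he : x * (1 + γ * x) = -(1 + x * u) := by linear_combination hq
    have hne : 1 + γ * x ≠ 0 := by
      intro h0
      rw [h0] at he
      linarith
    have hd : x / (1 + γ * x) = -(x ^ 2 / (1 + x * u)) := by
      rw [← neg_div, div_eq_div_iff hne hp.ne']
      linear_combination x * he
    simp only [f]
    rw [hd, hdiv x]
    ring
  have hcmp : α₁ ^ 2 / (1 + α₁ * u) < α₂ ^ 2 / (1 + α₂ * u) := by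
    rw [div_lt_div_iff₀ hA hB]
    have h : α₂ ^ 2 * (1 + α₁ * u) - α₁ ^ 2 * (1 + α₂ * u)
        = (α₂ - α₁) * (-(α₁ * α₂)) := by
      linear_combination (α₂ - α₁) * hrel
    have := mul_pos (sub_pos.mpr hlt) (neg_pos.mpr hneg)
    linarith
  have hc1 : 0 < α₁ ^ 2 / (1 + α₁ * u) := div_pos (sq_pos_of_neg ha1) hA
  refine ⟨?_, ha1, ha2, ?_, ?_⟩
  · have := mul_pos hκ hA
    have h : κ * (1 + α₁ * u) = κ + α₁ := by linear_combination α₁ * hu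
    linarith
  · rw [hval α₁ ha1.ne hA h₁, hval α₂ ha2.ne' hB h₂]
    exact neg_lt_neg (mul_lt_mul'' hcmp hpow hc1.le hpA.le)
  · rw [hval α₁ ha1.ne hA h₁]
    exact neg_neg_of_pos (mul_pos hc1 hpA)
end

section
/- Let γ < 0 and let α₁ < α₂ be the two real roots of γz² + z + 1 = 0 (real since 1 − 4γ > 0). Then f(α₂) < f(α₁) < 0, where f(x) := x·e^x/(1 + γx). -/
/-- For `γ < 0`, if `α₁ < α₂` are the two real roots of `γ z² + z + 1 = 0`, then
`f(α₂) < f(α₁) < 0`, where `f(x) = x eˣ/(1 + γx)`. -/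
theorem tsallis_infty_values_at_critical_points (γ α₁ α₂ : ℝ) (hγ : γ < 0)
    (hlt : α₁ < α₂)
    (h₁ : γ * α₁ ^ 2 + α₁ + 1 = 0)
    (h₂ : γ * α₂ ^ 2 + α₂ + 1 = 0) :
    α₂ * Real.exp α₂ / (1 + γ * α₂) < α₁ * Real.exp α₁ / (1 + γ * α₁) ∧
    α₁ * Real.exp α₁ / (1 + γ * α₁) < 0 := by
  have key : ∀ a : ℝ, γ * a ^ 2 + a + 1 = 0 →
      a ≠ 0 ∧ a * Real.exp a / (1 + γ * a) = -(a ^ 2 * Real.exp a) := by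
    intro a h
    have h0 : a * (1 + γ * a) = -1 := by linarith
    have hne : 1 + γ * a ≠ 0 := by
      intro hz
      rw [hz] at h0
      norm_num at h0
    refine ⟨?_, ?_⟩
    · rintro rfl
      norm_num at h0
    · rw [div_eq_iff hne]
      linear_combination (a * Real.exp a) * h0
  obtain ⟨ha, e₁⟩ := key α₁ h₁
  obtain ⟨-, e₂⟩ := key α₂ h₂
  rw [e₁, e₂]
  have hsum : γ * (α₁ + α₂) + 1 = 0 := by
    have : (α₂ - α₁) * (γ * (α₁ + α₂) + 1) = 0 := by linear_combination h₂ - h₁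
    rcases mul_eq_zero.mp this with h | h
    · linarith
    · exact h
  have hpos : 0 < α₁ + α₂ := by
    by_contra hn
    nlinarith
  have hsq : α₁ ^ 2 < α₂ ^ 2 := by nlinarith
  have hp : 0 < α₁ ^ 2 := by positivity
  have hexp : Real.exp α₁ < Real.exp α₂ := Real.exp_lt_exp.mpr hlt
  have hm : α₁ ^ 2 * Real.exp α₁ < α₂ ^ 2 * Real.exp α₂ :=
    mul_lt_mul'' hsq hexp hp.le (Real.exp_pos _).le
  have hq : 0 < α₁ ^ 2 * Real.exp α₁ := mul_pos hp (Real.exp_pos _)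
  constructor <;> linarith
end

section
/- Let U ⊆ ℂ be open, let f be holomorphic on U, and let p : ℝ → ℂ be a differentiable path with p(t) ∈ U for all t in an open interval around t₀, such that Im f(p(t)) = 0 for all t in that interval. If p'(t₀) ≠ 0 and the derivative of t ↦ Re f(p(t)) vanishes at t₀, then f'(p(t₀)) = 0. -/
/-- If a holomorphic function `f` on an open `U ⊆ ℂ` is real along a differentiable path `p`
(lying in `U` on an interval around `t₀`), and the derivative of `Re (f ∘ p)` vanishes at `t₀`
while `p'(t₀) ≠ 0`, then `f'(p(t₀)) = 0`. -/
theorem deriv_eq_zero_of_real_level_path (U : Set ℂ) (hU : IsOpen U) (f : ℂ → ℂ)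
    (hf : DifferentiableOn ℂ f U) (p : ℝ → ℂ) (t₀ ε : ℝ) (hε : 0 < ε)
    (hpU : ∀ t ∈ Set.Ioo (t₀ - ε) (t₀ + ε), p t ∈ U)
    (hpd : ∀ t ∈ Set.Ioo (t₀ - ε) (t₀ + ε), DifferentiableAt ℝ p t)
    (him : ∀ t ∈ Set.Ioo (t₀ - ε) (t₀ + ε), (f (p t)).im = 0)
    (hp0 : deriv p t₀ ≠ 0)
    (hre : deriv (fun t => (f (p t)).re) t₀ = 0) :
    deriv f (p t₀) = 0 := by
  have hmem : t₀ ∈ Set.Ioo (t₀ - ε) (t₀ + ε) := ⟨by linarith, by linarith⟩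
  have hfd : HasDerivAt f (deriv f (p t₀)) (p t₀) :=
    (hf.differentiableAt (hU.mem_nhds (hpU t₀ hmem))).hasDerivAt
  have hc : HasDerivAt (fun t => f (p t)) (deriv f (p t₀) * deriv p t₀) t₀ :=
    HasDerivAt.comp t₀ hfd (hpd t₀ hmem).hasDerivAt
  have h1 : HasDerivAt (fun t => (f (p t)).re) (deriv f (p t₀) * deriv p t₀).re t₀ :=
    Complex.reCLM.hasFDerivAt.comp_hasDerivAt t₀ hc
  have h2 : HasDerivAt (fun t => (f (p t)).im) (deriv f (p t₀) * deriv p t₀).im t₀ :=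
    Complex.imCLM.hasFDerivAt.comp_hasDerivAt t₀ hc
  have h3 : HasDerivAt (fun t => (f (p t)).im) 0 t₀ := by
    refine (hasDerivAt_const t₀ (0 : ℝ)).congr_of_eventuallyEq ?_
    filter_upwards [isOpen_Ioo.mem_nhds hmem] with t ht using him t ht
  have h4 : deriv f (p t₀) * deriv p t₀ = 0 :=
    Complex.ext (h1.deriv.symm.trans hre) (h2.unique h3)
  exact (mul_eq_zero.mp h4).resolve_right hp0
end

section
/- Let γ < 0 and define the open half-disc D := { z ∈ ℂ : Im z > 0 and (Re z + 1/γ)² + (Im z)² < (1 − γ)/γ² }. Then the map f(z) := z(1 + z)/(1 + γz) is a bijection from D onto the open upper half-plane ℂ⁺ = { w ∈ ℂ : Im w > 0 }. -/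
lemma tsallis_aux_ne (γ : ℝ) (hγ : γ < 0) (z : ℂ) (hz : 0 < z.im) : 1 + (γ : ℂ) * z ≠ 0 := by
  intro h
  have := congrArg Complex.im h
  simp at this
  rcases this with h | h <;> linarith

lemma tsallis_aux_im (γ : ℝ) (z : ℂ) (h0 : 1 + (γ : ℂ) * z ≠ 0) :
    (z * (1 + z) / (1 + (γ : ℂ) * z)).im * Complex.normSq (1 + (γ : ℂ) * z)
      = z.im * (1 + 2 * z.re + γ * (z.re ^ 2 + z.im ^ 2)) := by
  have hn : Complex.normSq (1 + (γ : ℂ) * z) ≠ 0 := by simpa using h0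
  rw [Complex.div_im, ← sub_div, div_mul_cancel₀ _ hn]
  simp
  ring

lemma tsallis_aux_disc (γ : ℝ) (hγ : γ < 0) (x y : ℝ) :
    (x + 1 / γ) ^ 2 + y ^ 2 < (1 - γ) / γ ^ 2 ↔ 0 < 1 + 2 * x + γ * (x ^ 2 + y ^ 2) := by
  have hne : γ ≠ 0 := hγ.ne
  rw [lt_div_iff₀ (by positivity)]
  have : ((x + 1 / γ) ^ 2 + y ^ 2) * γ ^ 2
      = 1 - γ + γ * (1 + 2 * x + γ * (x ^ 2 + y ^ 2)) := by
    field_simp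
    ring
  rw [this]
  constructor
  · intro h
    by_contra h'
    nlinarith
  · intro h
    nlinarith

lemma tsallis_aux_neg (γ : ℝ) (hγ : γ < 0) (z z' : ℂ)
    (h : (1 + (γ : ℂ) * z) * (1 + (γ : ℂ) * z') = 1 - γ) (hz : z.im ≠ 0) :
    z.im * z'.im < 0 := by
  have h1 := congrArg Complex.re h
  have h2 := congrArg Complex.im h
  simp at h1 h2
  have hb : 0 < (γ * z.im) ^ 2 := by have := hγ.ne; positivity
  have key : (γ * z'.im) * ((1 + γ * z.re) ^ 2 + (γ * z.im) ^ 2) = - (γ * z.im) * (1 - γ) := by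
    linear_combination (1 + γ * z.re) * h2 - (γ * z.im) * h1
  have key2 : (γ ^ 2 * (z.im * z'.im)) * ((1 + γ * z.re) ^ 2 + (γ * z.im) ^ 2)
      = - ((γ * z.im) ^ 2 * (1 - γ)) := by
    linear_combination (γ * z.im) * key
  have h3 : 0 < (γ * z.im) ^ 2 * (1 - γ) := mul_pos hb (by linarith)
  by_contra hc
  push Not at hc
  have : 0 ≤ (γ ^ 2 * (z.im * z'.im)) * ((1 + γ * z.re) ^ 2 + (γ * z.im) ^ 2) := by positivity
  linarith

lemma tsallis_aux_surj (γ : ℝ) (hγ : γ < 0) (w z : ℂ) (hw : 0 < w.im) (hz : 0 < z.im)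
    (h : z * (1 + z) = w * (1 + γ * z)) :
    ∃ z : ℂ, (0 < z.im ∧ (z.re + 1 / γ) ^ 2 + z.im ^ 2 < (1 - γ) / γ ^ 2) ∧
      z * (1 + z) / (1 + (γ : ℂ) * z) = w := by
  have h0 := tsallis_aux_ne γ hγ z hz
  have hf : z * (1 + z) / (1 + (γ : ℂ) * z) = w := by rw [div_eq_iff h0, h]
  refine ⟨z, ⟨hz, ?_⟩, hf⟩
  rw [tsallis_aux_disc γ hγ]
  have him := tsallis_aux_im γ z h0
  rw [hf] at him
  have : 0 < w.im * Complex.normSq (1 + (γ : ℂ) * z) := mul_pos hw (Complex.normSq_pos.2 h0)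
  rw [him] at this
  exact (mul_pos_iff_of_pos_left hz).1 this

/-- For `γ < 0`, the map `z ↦ z(1+z)/(1+γz)` is a bijection from the open half-disc
`{z : Im z > 0, (Re z + 1/γ)² + (Im z)² < (1-γ)/γ²}` onto the open upper half-plane. -/
theorem tsallis_one_bijOn_of_gamma_neg (γ : ℝ) (hγ : γ < 0) :
    Set.BijOn (fun z : ℂ => z * (1 + z) / (1 + (γ : ℂ) * z))
      {z : ℂ | 0 < z.im ∧ (z.re + 1 / γ) ^ 2 + z.im ^ 2 < (1 - γ) / γ ^ 2}
      {w : ℂ | 0 < w.im} := by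
  refine ⟨?_, ?_, ?_⟩
  · rintro z ⟨hz, hd⟩
    rw [tsallis_aux_disc γ hγ] at hd
    have h0 := tsallis_aux_ne γ hγ z hz
    have him := tsallis_aux_im γ z h0
    have hp := mul_pos hz hd
    rw [← him] at hp
    exact (mul_pos_iff_of_pos_right (Complex.normSq_pos.2 h0)).1 hp
  · rintro z ⟨hz, -⟩ z' ⟨hz', -⟩ h
    have h0 := tsallis_aux_ne γ hγ z hz
    have h0' := tsallis_aux_ne γ hγ z' hz'
    simp only at h
    rw [div_eq_div_iff h0 h0'] at h
    by_contra hne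
    have hs : z - z' ≠ 0 := sub_ne_zero.2 hne
    have h1 : γ * (z * z') + z + z' + 1 = 0 := by
      apply mul_left_cancel₀ hs
      linear_combination h
    have := tsallis_aux_neg γ hγ z z' (by linear_combination (γ : ℂ) * h1) hz.ne'
    have := mul_pos hz hz'
    linarith
  · intro w hw
    have hw : 0 < w.im := hw
    obtain ⟨s, hs⟩ := IsAlgClosed.exists_pow_nat_eq ((1 - γ * w) ^ 2 + 4 * w) (n := 2) (by norm_num)
    obtain ⟨z, hzdef⟩ : ∃ z : ℂ, z = (γ * w - 1 + s) / 2 := ⟨_, rfl⟩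
    obtain ⟨z', hzdef'⟩ : ∃ z' : ℂ, z' = (γ * w - 1 - s) / 2 := ⟨_, rfl⟩
    have h : z * (1 + z) = w * (1 + γ * z) := by
      rw [hzdef]; linear_combination hs / 4
    have h' : z' * (1 + z') = w * (1 + γ * z') := by
      rw [hzdef']; linear_combination hs / 4
    have hp : (1 + (γ : ℂ) * z) * (1 + (γ : ℂ) * z') = 1 - γ := by
      rw [hzdef, hzdef']; linear_combination -(γ : ℂ) ^ 2 * hs / 4
    rcases lt_trichotomy z.im 0 with hz | hz | hz
    · have hn := tsallis_aux_neg γ hγ z z' hp hz.ne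
      have hz' : 0 < z'.im := by
        by_contra hc
        push Not at hc
        nlinarith
      exact tsallis_aux_surj γ hγ w z' hw hz' h'
    · exfalso
      have h2 := congrArg Complex.im h
      have hp1 := congrArg Complex.re hp
      have hp2 := congrArg Complex.im hp
      simp [hz] at h2 hp1 hp2
      rcases h2 with h2 | h2
      · linarith
      · rw [h2] at hp1
        simp at hp1
        linarith
    · exact tsallis_aux_surj γ hγ w z hw hz h
end

section
/- Let 0 < γ < 1 and define the open set D := { z ∈ ℂ : Im z > 0 and (Re z + 1/γ)² + (Im z)² > (1 − γ)/γ² }. Then the map f(z) := z(1 + z)/(1 + γz) is a bijection from D onto the open upper half-plane ℂ⁺ = { w ∈ ℂ : Im w > 0 }. -/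
theorem tsallis_aux_im_s18 (R : ℝ) (u : ℂ) (hu : u ≠ 0) :
    (u + (R : ℂ) / u).im * (u.re ^ 2 + u.im ^ 2) = u.im * (u.re ^ 2 + u.im ^ 2 - R) := by
  have h : u.re ^ 2 + u.im ^ 2 ≠ 0 := by
    have := (Complex.normSq_pos.2 hu).ne'
    rw [Complex.normSq_apply] at this
    intro h; apply this; linarith
  have h' : u.re * u.re + u.im * u.im ≠ 0 := by
    intro h2; apply h; linarith
  simp only [Complex.add_im, Complex.div_im, Complex.ofReal_re, Complex.ofReal_im,
    Complex.normSq_apply]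
  field_simp
  ring

theorem tsallis_aux_f (γ : ℝ) (hγ0 : 0 < γ) (u : ℂ) (hu : u ≠ 0) :
    (u - ((1 / γ : ℝ) : ℂ)) * (1 + (u - ((1 / γ : ℝ) : ℂ))) /
      (1 + (γ : ℂ) * (u - ((1 / γ : ℝ) : ℂ)))
    = ((1 / γ : ℝ) : ℂ) * ((u + (((1 - γ) / γ ^ 2 : ℝ) : ℂ) / u) + ((1 - 2 / γ : ℝ) : ℂ)) := by
  have hg : (γ : ℂ) ≠ 0 := by exact_mod_cast hγ0.ne'
  have h1 : (1 + (γ : ℂ) * (u - ((1 / γ : ℝ) : ℂ))) = γ * u := by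
    push_cast; field_simp; ring
  rw [h1]
  push_cast
  field_simp
  ring

theorem tsallis_aux_bij (R : ℝ) (hR : 0 < R) :
    Set.BijOn (fun u : ℂ => u + (R : ℂ) / u)
      {u : ℂ | 0 < u.im ∧ u.re ^ 2 + u.im ^ 2 > R} {w : ℂ | 0 < w.im} := by
  have hRc : (R : ℂ) ≠ 0 := by exact_mod_cast hR.ne'
  have ne0 : ∀ u : ℂ, 0 < u.im → u ≠ 0 := by
    rintro u h rfl; simp at h
  refine ⟨?_, ?_, ?_⟩
  · rintro u ⟨h1, h2⟩
    have := tsallis_aux_im_s18 R u (ne0 u h1)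
    have h3 : 0 < u.im * (u.re ^ 2 + u.im ^ 2 - R) := mul_pos h1 (by linarith)
    rw [← this] at h3
    exact pos_of_mul_pos_left h3 (by positivity)
  · rintro u ⟨hu1, hu2⟩ v ⟨hv1, hv2⟩ h
    have hu := ne0 u hu1
    have hv := ne0 v hv1
    simp only at h
    field_simp at h
    have h2 : (u - v) * (u * v - R) = 0 := by linear_combination h
    rcases mul_eq_zero.1 h2 with h3 | h3
    · exact sub_eq_zero.1 h3
    · exfalso
      have h4 := congrArg Complex.normSq (sub_eq_zero.1 h3)
      rw [Complex.normSq_mul, Complex.normSq_ofReal, Complex.normSq_apply,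
        Complex.normSq_apply] at h4
      nlinarith
  · intro c hc
    have hc : 0 < c.im := hc
    obtain ⟨s, hs⟩ := IsAlgClosed.exists_pow_nat_eq (c ^ 2 - 4 * R) (n := 2) (by norm_num)
    have hprod : ((c + s) / 2) * ((c - s) / 2) = R := by linear_combination -hs / 4
    have main : ∀ u v : ℂ, u * v = R → u + v = c → u.re ^ 2 + u.im ^ 2 > R →
        ∃ x ∈ {u : ℂ | 0 < u.im ∧ u.re ^ 2 + u.im ^ 2 > R}, x + (R : ℂ) / x = c := by
      intro u v h1 h2 h3
      have hu : u ≠ 0 := by rintro rfl; simp at h1; exact hRc (by simp [← h1])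
      have h4 : u + (R : ℂ) / u = c := by
        rw [← h1, ← h2]; field_simp
      have h5 := tsallis_aux_im_s18 R u hu
      rw [h4] at h5
      refine ⟨u, ⟨?_, h3⟩, h4⟩
      have h6 : 0 < c.im * (u.re ^ 2 + u.im ^ 2) := mul_pos hc (by linarith)
      rw [h5] at h6
      exact pos_of_mul_pos_left h6 (by linarith)
    generalize hu : (c + s) / 2 = u at hprod
    generalize hv : (c - s) / 2 = v at hprod
    have hsum : u + v = c := by rw [← hu, ← hv]; ring
    have h4 := congrArg Complex.normSq hprod
    rw [Complex.normSq_mul, Complex.normSq_ofReal, Complex.normSq_apply,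
      Complex.normSq_apply] at h4
    rcases lt_trichotomy R (u.re ^ 2 + u.im ^ 2) with h | h | h
    · exact main u v hprod hsum h
    · exfalso
      have hu0 : u ≠ 0 := by rintro rfl; simp at h; exact hR.ne' h
      have h5 := tsallis_aux_im_s18 R u hu0
      have h6 : u + (R : ℂ) / u = c := by
        rw [← hprod, ← hsum]; field_simp
      rw [h6, ← h] at h5
      have := mul_pos hc hR
      linarith
    · refine main v u (by rw [mul_comm]; exact hprod) (by rw [add_comm]; exact hsum) ?_
      by_contra h7
      push Not at h7
      nlinarith [sq_nonneg u.re, sq_nonneg u.im, sq_nonneg v.re, sq_nonneg v.im,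
        mul_le_mul_of_nonneg_left h7 (by positivity : 0 ≤ u.re ^ 2 + u.im ^ 2)]

/-- For `0 < γ < 1`, the map `z ↦ z(1+z)/(1+γz)` is a bijection from the part of the upper
half-plane exterior to the disc `(Re z + 1/γ)² + (Im z)² ≤ (1-γ)/γ²` onto the upper half-plane. -/
theorem tsallis_one_bijOn_of_gamma_pos (γ : ℝ) (hγ0 : 0 < γ) (hγ1 : γ < 1) :
    Set.BijOn (fun z : ℂ => z * (1 + z) / (1 + (γ : ℂ) * z))
      {z : ℂ | 0 < z.im ∧ (z.re + 1 / γ) ^ 2 + z.im ^ 2 > (1 - γ) / γ ^ 2}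
      {w : ℂ | 0 < w.im} := by
  have hg : (γ : ℂ) ≠ 0 := by exact_mod_cast hγ0.ne'
  have hR : 0 < (1 - γ) / γ ^ 2 := div_pos (by linarith) (by positivity)
  obtain ⟨hm, hi, hs⟩ := tsallis_aux_bij _ hR
  have ne0 : ∀ u : ℂ, 0 < u.im → u ≠ 0 := by
    rintro u h rfl; simp at h
  have hf : ∀ z : ℂ, 0 < z.im → z * (1 + z) / (1 + (γ : ℂ) * z) =
      ((1 / γ : ℝ) : ℂ) * (((z + ((1 / γ : ℝ) : ℂ)) +
        (((1 - γ) / γ ^ 2 : ℝ) : ℂ) / (z + ((1 / γ : ℝ) : ℂ))) + ((1 - 2 / γ : ℝ) : ℂ)) := by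
    intro z hz
    have := tsallis_aux_f γ hγ0 (z + ((1 / γ : ℝ) : ℂ)) (ne0 _ (by
      rw [Complex.add_im, Complex.ofReal_im]; linarith))
    rwa [add_sub_cancel_right] at this
  have hmem : ∀ z : ℂ, (0 < z.im ∧ (z.re + 1 / γ) ^ 2 + z.im ^ 2 > (1 - γ) / γ ^ 2) →
      z + ((1 / γ : ℝ) : ℂ) ∈ {u : ℂ | 0 < u.im ∧ u.re ^ 2 + u.im ^ 2 > (1 - γ) / γ ^ 2} := by
    intro z hz
    simpa only [Set.mem_setOf_eq, Complex.add_im, Complex.add_re, Complex.ofReal_im,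
      Complex.ofReal_re, add_zero] using hz
  have hg' : ((1 / γ : ℝ) : ℂ) ≠ 0 := by
    exact_mod_cast (one_div_pos.2 hγ0).ne'
  refine ⟨?_, ?_, ?_⟩
  · intro z hz
    have h1 := hm (hmem z hz)
    simp only [Set.mem_setOf_eq] at h1 ⊢
    rw [hf z hz.1, Complex.im_ofReal_mul, Complex.add_im _ ((1 - 2 / γ : ℝ) : ℂ),
      Complex.ofReal_im, add_zero]
    exact mul_pos (one_div_pos.2 hγ0) h1
  · intro z hz w hw h
    simp only at h
    rw [hf z hz.1, hf w hw.1] at h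
    have h2 := add_right_cancel (mul_left_cancel₀ hg' h)
    exact add_right_cancel (hi (hmem z hz) (hmem w hw) h2)
  · intro w hw
    have hw : 0 < w.im := hw
    have : (γ : ℂ) * w - ((1 - 2 / γ : ℝ) : ℂ) ∈ {w : ℂ | 0 < w.im} := by
      simp only [Set.mem_setOf_eq]
      rw [Complex.sub_im, Complex.im_ofReal_mul, Complex.ofReal_im, sub_zero]
      positivity
    obtain ⟨u, hu, h⟩ := hs this
    simp only at h
    have h1 : 0 < (u - ((1 / γ : ℝ) : ℂ)).im := by
      rw [Complex.sub_im, Complex.ofReal_im, sub_zero]; exact hu.1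
    refine ⟨u - ((1 / γ : ℝ) : ℂ), ⟨h1, ?_⟩, ?_⟩
    · rw [Complex.sub_im, Complex.sub_re, Complex.ofReal_im, Complex.ofReal_re, sub_zero,
        sub_add_cancel]
      exact hu.2
    · simp only
      rw [hf _ h1, sub_add_cancel, h, sub_add_cancel]
      push_cast
      field_simp
end

section
/- Define the open set D := { x + iy ∈ ℂ : 0 < y < π and x > −y·cot y }. Then the map f(z) := z·e^z is a bijection from D onto the open upper half-plane ℂ⁺ = { w ∈ ℂ : Im w > 0 }. -/
lemma lamb_cot {x y : ℝ} (h0 : 0 < y) (h1 : y < Real.pi) :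
    x > -y * Real.cot y ↔ 0 < x * Real.sin y + y * Real.cos y := by
  have hs := Real.sin_pos_of_pos_of_lt_pi h0 h1
  rw [Real.cot_eq_cos_div_sin]
  have : x * Real.sin y + y * Real.cos y
      = (x - (-y * (Real.cos y / Real.sin y))) * Real.sin y := by
    field_simp
    ring
  rw [this, mul_pos_iff_of_pos_right hs, gt_iff_lt, sub_pos]

lemma lamb_im (z : ℂ) : (z * Complex.exp z).im
    = Real.exp z.re * (z.re * Real.sin z.im + z.im * Real.cos z.im) := by
  rw [Complex.mul_im, Complex.exp_re, Complex.exp_im]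
  ring

lemma lamb_polar (z : ℂ) : z * Complex.exp z
    = ((‖z‖ * Real.exp z.re : ℝ) : ℂ) * (Complex.cos ((z.arg + z.im : ℝ) : ℂ)
      + Complex.sin ((z.arg + z.im : ℝ) : ℂ) * Complex.I) := by
  rw [← Complex.exp_mul_I]
  conv_lhs => rw [← Complex.norm_mul_exp_arg_mul_I z]
  rw [Complex.norm_mul_exp_arg_mul_I z]
  conv_lhs => rw [← Complex.re_add_im z, Complex.exp_add, Complex.re_add_im z]
  conv_lhs => enter [1]; rw [← Complex.norm_mul_exp_arg_mul_I z]
  push_cast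
  rw [add_mul, Complex.exp_add]
  ring

lemma lamb_arg {z : ℂ} (h0 : 0 < z.im) (h1 : z.im < Real.pi)
    (h2 : 0 < (z * Complex.exp z).im) :
    (z * Complex.exp z).arg = z.arg + z.im ∧ 0 < z.arg ∧ z.arg + z.im < Real.pi := by
  have hz : z ≠ 0 := by rintro rfl; simp at h0
  have hn : 0 < ‖z‖ := norm_pos_iff.mpr hz
  have ha0 : 0 < z.arg := by
    rcases (Complex.arg_nonneg_iff.mpr h0.le).lt_or_eq with h | h
    · exact h
    · have := (Complex.arg_eq_zero_iff.mp h.symm).2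
      linarith
  have har : z.arg ≤ Real.pi := Complex.arg_le_pi z
  have hr : 0 < ‖z‖ * Real.exp z.re := by positivity
  have him : (z * Complex.exp z).im = ‖z‖ * Real.exp z.re * Real.sin (z.arg + z.im) := by
    rw [lamb_polar z, Complex.im_ofReal_mul, ← Complex.ofReal_cos, ← Complex.ofReal_sin]
    simp only [Complex.add_im, Complex.ofReal_im, Complex.im_ofReal_mul, Complex.I_im, mul_one, zero_add]
  have hlt : z.arg + z.im < Real.pi := by
    by_contra hcon
    push Not at hcon
    have : 0 ≤ Real.sin (z.arg + z.im - Real.pi) :=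
      Real.sin_nonneg_of_nonneg_of_le_pi (by linarith) (by linarith)
    rw [Real.sin_sub_pi] at this
    rw [him] at h2
    have := (mul_pos_iff_of_pos_left hr).mp h2
    linarith
  refine ⟨?_, ha0, hlt⟩
  rw [lamb_polar z]
  exact Complex.arg_mul_cos_add_sin_mul_I hr ⟨by linarith, hlt.le⟩

lemma lamb_mono (θ : ℝ) (h1 : θ < Real.pi) :
    StrictMonoOn (fun y : ℝ => Real.log y - Real.log (Real.sin (θ - y))
      + y * (Real.cos (θ - y) / Real.sin (θ - y))) (Set.Ioo 0 θ) := by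
  have key : ∀ y ∈ Set.Ioo 0 θ, HasDerivAt (fun y : ℝ => Real.log y - Real.log (Real.sin (θ - y))
      + y * (Real.cos (θ - y) / Real.sin (θ - y)))
      ((1 + y * (Real.cos (θ - y) / Real.sin (θ - y))) ^ 2 / y + y) y := by
    rintro y ⟨hy0, hy1⟩
    have hs : 0 < Real.sin (θ - y) :=
      Real.sin_pos_of_pos_of_lt_pi (by linarith) (by linarith)
    have hd : HasDerivAt (fun y : ℝ => θ - y) (-1) y := by
      simpa using (hasDerivAt_id y).const_sub θ
    have hsin := hd.sin
    have hcos := hd.cos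
    have := ((Real.hasDerivAt_log hy0.ne').sub (hsin.log hs.ne')).add
      ((hasDerivAt_id y).mul (hcos.div hsin hs.ne'))
    refine this.congr_deriv ?_
    simp only [id, Pi.div_apply]
    have e := Real.sin_sq_add_cos_sq (θ - y)
    generalize Real.sin (θ - y) = s at *
    generalize Real.cos (θ - y) = c at *
    have e' : c ^ 2 = 1 - s ^ 2 := by linarith
    field_simp
    ring
  apply strictMonoOn_of_deriv_pos (convex_Ioo 0 θ)
  · intro y hy
    exact (key y hy).continuousAt.continuousWithinAt
  · intro y hy
    rw [interior_Ioo] at hy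
    rw [(key y hy).deriv]
    have := hy.1
    positivity

lemma lamb_eq {z : ℂ} (h0 : 0 < z.im) (h1 : z.im < Real.pi)
    (h2 : 0 < (z * Complex.exp z).im) {θ : ℝ} (hθ : θ = (z * Complex.exp z).arg) :
    z.im ∈ Set.Ioo 0 θ ∧ θ < Real.pi ∧
    z.re = z.im * (Real.cos (θ - z.im) / Real.sin (θ - z.im)) ∧
    Real.log ‖z * Complex.exp z‖ = Real.log z.im - Real.log (Real.sin (θ - z.im))
      + z.im * (Real.cos (θ - z.im) / Real.sin (θ - z.im)) := by
  obtain ⟨ha, hb, hc⟩ := lamb_arg h0 h1 h2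
  have hz : z ≠ 0 := by rintro rfl; simp at h0
  have hn : 0 < ‖z‖ := norm_pos_iff.mpr hz
  have hθ' : θ - z.im = z.arg := by rw [hθ, ha]; ring
  have hs : 0 < Real.sin z.arg := Real.sin_pos_of_pos_of_lt_pi hb (by linarith)
  have hre : z.re = ‖z‖ * Real.cos z.arg := (Complex.norm_mul_cos_arg z).symm
  have him : z.im = ‖z‖ * Real.sin z.arg := (Complex.norm_mul_sin_arg z).symm
  have hx : z.re = z.im * (Real.cos z.arg / Real.sin z.arg) := by
    rw [hre]
    nth_rewrite 1 [him]
    field_simp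
  refine ⟨⟨h0, by linarith⟩, by linarith, ?_, ?_⟩
  · rw [hθ', ← hx]
  · rw [hθ', ← hx, norm_mul, Complex.norm_exp, Real.log_mul hn.ne' (Real.exp_pos _).ne',
      Real.log_exp]
    have : Real.log z.im = Real.log ‖z‖ + Real.log (Real.sin z.arg) := by
      rw [← Real.log_mul hn.ne' hs.ne', ← him]
    linarith

lemma lamb_ivt {θ R : ℝ} (h0 : 0 < θ) (h1 : θ < Real.pi) (hR : 0 < R) :
    ∃ y ∈ Set.Ioo 0 θ, y / Real.sin (θ - y)
      * Real.exp (y * (Real.cos (θ - y) / Real.sin (θ - y))) = R := by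
  obtain ⟨δ, hδ0, hδ1, hδ2⟩ : ∃ δ : ℝ, 0 < δ ∧ δ ≤ θ / 2 ∧ R * δ ≤ θ / 2 := by
    refine ⟨min (θ / 2) (θ / (2 * R)), by positivity, min_le_left _ _, ?_⟩
    calc R * min (θ / 2) (θ / (2 * R)) ≤ R * (θ / (2 * R)) := by
          gcongr
          exact min_le_right _ _
      _ = θ / 2 := by field_simp
  have hcont : ContinuousOn (fun y : ℝ => y / Real.sin (θ - y)
      * Real.exp (y * (Real.cos (θ - y) / Real.sin (θ - y)))) (Set.Icc 0 (θ - δ)) := by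
    have hs : ∀ y ∈ Set.Icc 0 (θ - δ), Real.sin (θ - y) ≠ 0 := fun y hy =>
      (Real.sin_pos_of_pos_of_lt_pi (by linarith [hy.2]) (by linarith [hy.1])).ne'
    fun_prop (disch := assumption)
  have hmem : R ∈ Set.Icc ((fun y : ℝ => y / Real.sin (θ - y)
      * Real.exp (y * (Real.cos (θ - y) / Real.sin (θ - y)))) 0)
      ((fun y : ℝ => y / Real.sin (θ - y)
      * Real.exp (y * (Real.cos (θ - y) / Real.sin (θ - y)))) (θ - δ)) := by
    refine ⟨by simpa using hR.le, ?_⟩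
    simp only [sub_sub_cancel]
    have hs : 0 < Real.sin δ := Real.sin_pos_of_pos_of_lt_pi hδ0 (by linarith)
    have hc : 0 ≤ Real.cos δ := Real.cos_nonneg_of_mem_Icc ⟨by linarith, by linarith⟩
    have hsd : Real.sin δ ≤ δ := Real.sin_le hδ0.le
    have hq : R ≤ (θ - δ) / Real.sin δ := by
      rw [le_div_iff₀ hs]
      nlinarith
    have he : 1 ≤ Real.exp ((θ - δ) * (Real.cos δ / Real.sin δ)) := by
      apply Real.one_le_exp
      have : 0 ≤ θ - δ := by linarith
      positivity
    nlinarith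
  obtain ⟨y, hy, hyR⟩ := intermediate_value_Icc (by linarith) hcont hmem
  refine ⟨y, ⟨lt_of_le_of_ne hy.1 ?_, by linarith [hy.2]⟩, hyR⟩
  rintro rfl
  simp at hyR
  linarith

/-- The map `z ↦ z eᶻ` is a bijection from `{x + iy : 0 < y < π, x > -y cot y}` onto the
open upper half-plane (principal branch of the Lambert W function). -/
theorem lambert_bijOn :
    Set.BijOn (fun z : ℂ => z * Complex.exp z)
      {z : ℂ | 0 < z.im ∧ z.im < Real.pi ∧ z.re > -z.im * Real.cot z.im}
      {w : ℂ | 0 < w.im} := by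
  have hmaps : ∀ z : ℂ, (0 < z.im ∧ z.im < Real.pi ∧ z.re > -z.im * Real.cot z.im) →
      0 < (z * Complex.exp z).im := by
    rintro z ⟨h0, h1, h2⟩
    rw [lamb_im]
    exact mul_pos (Real.exp_pos _) ((lamb_cot h0 h1).mp h2)
  refine ⟨fun z hz => hmaps z hz, ?_, ?_⟩
  · intro z hz z' hz' heq
    simp only at heq
    obtain ⟨a1, a2, a3, a4⟩ := lamb_eq hz.1 hz.2.1 (hmaps z hz) rfl
    obtain ⟨b1, b2, b3, b4⟩ := lamb_eq hz'.1 hz'.2.1 (hmaps z' hz') (congrArg Complex.arg heq)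
    have him : z.im = z'.im := by
      apply (lamb_mono _ a2).injOn a1 b1
      simp only
      rw [← a4, ← b4, heq]
    apply Complex.ext _ him
    rw [a3, b3, him]
  · intro w hw
    have hw : 0 < w.im := hw
    have hw0 : w ≠ 0 := by rintro rfl; simp at hw
    have hR : 0 < ‖w‖ := norm_pos_iff.mpr hw0
    have hθ1 : w.arg < Real.pi := by
      refine lt_of_le_of_ne (Complex.arg_le_pi w) fun h => ?_
      have := (Complex.arg_eq_pi_iff.mp h).2
      linarith
    have hθ0 : 0 < w.arg := by
      refine lt_of_le_of_ne (Complex.arg_nonneg_iff.mpr hw.le) fun h => ?_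
      have := (Complex.arg_eq_zero_iff.mp h.symm).2
      linarith
    obtain ⟨y, hy, hyR⟩ := lamb_ivt hθ0 hθ1 hR
    have hs : 0 < Real.sin (w.arg - y) :=
      Real.sin_pos_of_pos_of_lt_pi (by linarith [hy.2]) (by linarith [hy.1])
    have hfz : (⟨y * (Real.cos (w.arg - y) / Real.sin (w.arg - y)), y⟩ : ℂ)
        * Complex.exp ⟨y * (Real.cos (w.arg - y) / Real.sin (w.arg - y)), y⟩ = w := by
      have e1 := Real.cos_add (w.arg - y) y
      have e2 := Real.sin_add (w.arg - y) y
      rw [sub_add_cancel] at e1 e2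
      apply Complex.ext
      · rw [← Complex.norm_mul_cos_arg w, ← hyR, Complex.mul_re, Complex.exp_re, Complex.exp_im,
          e1]
        simp only
        field_simp
      · rw [← Complex.norm_mul_sin_arg w, ← hyR, lamb_im, e2]
        simp only
        field_simp
        ring
    refine ⟨⟨y * (Real.cos (w.arg - y) / Real.sin (w.arg - y)), y⟩, ?_, hfz⟩
    have hyp : y < Real.pi := hy.2.trans hθ1
    refine ⟨hy.1, hyp, (lamb_cot hy.1 hyp).mpr ?_⟩
    rw [← hfz, lamb_im] at hw
    exact (mul_pos_iff_of_pos_left (Real.exp_pos _)).mp hw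
end
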